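/- arXiv:2411.10675 — 2 statements merged into one kernel-verified Lean document; each statement's English description precedes it below -/
import Mathlib

section
/- Let 0 < α < 2 and let u(x) = (1−|x|²)_+^p with p > 0 on ℝ^d. Then for |x| < 1, (−Δ)^{α/2} u(x) = [2^α Γ((α+d)/2) Γ(p+1) / (Γ(d/2) Γ(p+1−α/2))] · ₂F₁((α+d)/2, α/2 − p; d/2; |x|²), provided p + 1 − α/2 is not a nonpositive integer. -/
open MeasureTheory Filter

/-- Normalization constant `c_{d,α} = 2^α Γ((α+d)/2)/(π^{d/2}|Γ(−α/2)|)`. -/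
noncomputable def cFrac (d : ℕ) (α : ℝ) : ℝ :=
  2 ^ α * Real.Gamma ((α + d) / 2) /
    (Real.pi ^ ((d : ℝ) / 2) * |Real.Gamma (-α / 2)|)

/-- The principal-value integral fractional Laplacian:
`fracLapPV d α v x L` says `(−Δ)^{α/2} v(x) = L`. -/
noncomputable def fracLapPV (d : ℕ) (α : ℝ) (v : EuclideanSpace ℝ (Fin d) → ℝ)
    (x : EuclideanSpace ℝ (Fin d)) (L : ℝ) : Prop :=
  Tendsto (fun ε : ℝ =>
      cFrac d α *
        ∫ y in {y : EuclideanSpace ℝ (Fin d) | ε < ‖x - y‖},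
          (v x - v y) / ‖x - y‖ ^ ((d : ℝ) + α))
    (nhdsWithin 0 (Set.Ioi 0)) (nhds L)

/-- The Gauss hypergeometric function `₂F₁(a,b;c;z)` as a power series. -/
noncomputable def hyp2F1 (a b c z : ℝ) : ℝ :=
  ∑' n : ℕ, ((ascPochhammer ℝ n).eval a * (ascPochhammer ℝ n).eval b /
    ((ascPochhammer ℝ n).eval c * (n.factorial : ℝ))) * z ^ n


/-- Terminating hypergeometric polynomials `₂F₁(-N,a;c;v)`, defined by a recursion. -/
noncomputable def TT : ℕ → ℝ → ℝ → ℝ → ℝ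
  | 0, _, _, _ => 1
  | N + 1, a, c, v => TT N a c v - a / c * v * TT N (a + 1) (c + 1) v

lemma TT_zero (a c v : ℝ) : TT 0 a c v = 1 := rfl
lemma TT_succ (N : ℕ) (a c v : ℝ) :
    TT (N + 1) a c v = TT N a c v - a / c * v * TT N (a + 1) (c + 1) v := rfl

lemma TT_at_zero (N : ℕ) (a c : ℝ) : TT N a c 0 = 1 := by
  induction N generalizing a c with
  | zero => rfl
  | succ N ih => simp [TT_succ, ih]

lemma TT_contig (N : ℕ) : ∀ a c v : ℝ, 0 < c →
    TT N a c v = a / c * TT N (a + 1) (c + 1) v + (1 - a / c) * TT N a (c + 1) v := by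
  induction N with
  | zero => intro a c v hc; simp [TT_zero]
  | succ N ih =>
    intro a c v hc
    rw [TT_succ, TT_succ, TT_succ, ih a c v hc, ih (a + 1) (c + 1) v (by linarith)]
    field_simp
    ring

lemma TT_bound (N : ℕ) : ∀ a c v : ℝ, 0 ≤ a → a ≤ c → 0 < c → 0 ≤ v → v ≤ 2 →
    |TT N a c v| ≤ 1 := by
  induction N with
  | zero => intro a c v _ _ _ _ _; simp [TT_zero]
  | succ N ih =>
    intro a c v ha hac hc hv hv2
    have h1 := ih (a + 1) (c + 1) v (by linarith) (by linarith) (by linarith) hv hv2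
    have h2 := ih a (c + 1) v ha (by linarith) (by linarith) hv hv2
    have e : TT (N + 1) a c v = a / c * ((1 - v) * TT N (a + 1) (c + 1) v)
        + (1 - a / c) * TT N a (c + 1) v := by
      rw [TT_succ, TT_contig N a c v hc]; ring
    have hq0 : 0 ≤ a / c := by positivity
    have hq1 : a / c ≤ 1 := by rw [div_le_one hc]; exact hac
    have h3 : |(1 - v) * TT N (a + 1) (c + 1) v| ≤ 1 := by
      rw [abs_mul]
      have : |1 - v| ≤ 1 := by rw [abs_le]; constructor <;> linarith
      exact mul_le_one₀ this (abs_nonneg _) h1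
    rw [e]
    calc _ ≤ |a / c * ((1 - v) * TT N (a + 1) (c + 1) v)| + |(1 - a / c) * TT N a (c + 1) v| :=
          abs_add_le _ _
      _ = a / c * |(1 - v) * TT N (a + 1) (c + 1) v| + (1 - a / c) * |TT N a (c + 1) v| := by
          rw [abs_mul, abs_mul (1 - a / c), abs_of_nonneg hq0,
            abs_of_nonneg (by linarith : 0 ≤ 1 - a / c)]
      _ ≤ a / c * 1 + (1 - a / c) * 1 := by
          have : 0 ≤ 1 - a / c := by linarith
          gcongr
      _ = 1 := by ring

/-- derivative of `TT N a c` -/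
noncomputable def T1 (N : ℕ) (a c v : ℝ) : ℝ := -N * (a / c) * TT (N - 1) (a + 1) (c + 1) v

lemma TT_hasDerivAt (N : ℕ) : ∀ a c v : ℝ, 0 < c → HasDerivAt (TT N a c) (T1 N a c v) v := by
  induction N with
  | zero =>
    intro a c v hc
    have : TT 0 a c = fun _ => (1 : ℝ) := by funext; rfl
    rw [this]; simpa [T1] using hasDerivAt_const v (1 : ℝ)
  | succ N ih =>
    intro a c v hc
    have h := (ih a c v hc).sub ((((hasDerivAt_id v).const_mul (a / c))).mul
      (ih (a + 1) (c + 1) v (by linarith)))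
    have e : TT (N + 1) a c = (TT N a c - (fun y => a / c * id y) * TT N (a + 1) (c + 1)) := by
      funext y; simp [TT_succ]
    rw [e]
    convert! h using 1
    cases N with
    | zero => simp [T1, TT_zero]
    | succ M =>
      simp only [T1, Nat.add_sub_cancel, id, TT_succ]
      push_cast
      ring

lemma TT_D (N : ℕ) (a c v : ℝ) : v * T1 N a c v = N * (TT N a c v - TT (N - 1) a c v) := by
  cases N with
  | zero => simp [T1]
  | succ N => simp only [T1, Nat.add_sub_cancel, TT_succ]; push_cast; ring

/-- derivative of `T1` -/
noncomputable def T2 (N : ℕ) (a c v : ℝ) : ℝ := -N * (a / c) * T1 (N - 1) (a + 1) (c + 1) v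

lemma T1_hasDerivAt (N : ℕ) (a c v : ℝ) (hc : 0 < c) :
    HasDerivAt (T1 N a c) (T2 N a c v) v := by
  exact (TT_hasDerivAt (N - 1) (a + 1) (c + 1) v (by linarith)).const_mul _

lemma T1_succ (N : ℕ) (a c v : ℝ) (hc : 0 < c) :
    T1 (N + 1) a c v = T1 N a c v - a / c * (TT N (a + 1) (c + 1) v + v * T1 N (a + 1) (c + 1) v) := by
  have h := (TT_hasDerivAt N a c v hc).sub ((((hasDerivAt_id v).const_mul (a / c))).mul
      (TT_hasDerivAt N (a + 1) (c + 1) v (by linarith)))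
  have e : TT (N + 1) a c = (TT N a c - (fun y => a / c * id y) * TT N (a + 1) (c + 1)) := by
    funext y; simp [TT_succ]
  rw [← e] at h
  rw [(TT_hasDerivAt (N + 1) a c v hc).unique h]
  simp; ring

lemma TT_up (N : ℕ) : ∀ a c v : ℝ, 0 < c →
    a * TT N a c v + v * T1 N a c v = a * TT N (a + 1) c v := by
  induction N with
  | zero => intro a c v hc; simp [TT_zero, T1]
  | succ N ih =>
    intro a c v hc
    have h1 := ih a c v hc
    have h2 := ih (a + 1) (c + 1) v (by linarith)
    rw [T1_succ N a c v hc, TT_succ, TT_succ]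
    linear_combination h1 - a / c * v * h2

lemma TT_down (N : ℕ) : ∀ a c v : ℝ, 0 < c →
    c * TT N a (c + 1) v + v * T1 N a (c + 1) v = c * TT N a c v := by
  induction N with
  | zero => intro a c v hc; simp [TT_zero, T1]
  | succ N ih =>
    intro a c v hc
    have h1 := ih a c v hc
    have h2 := ih (a + 1) (c + 1) v (by linarith)
    rw [T1_succ N a (c + 1) v (by linarith), TT_succ, TT_succ]
    have : a / c * c = a := by field_simp
    have : a / (c + 1) * (c + 1) = a := by field_simp
    linear_combination h1 - a / (c + 1) * v * h2 + v * TT N (a + 1) (c + 1) v * (‹a / c * c = a› -  this)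

/-- hypergeometric equation -/
lemma TT_hyp (N : ℕ) (a c v : ℝ) (hc : 0 < c) :
    c * T1 N a c v + v * T2 N a c v =
      -N * (a * TT (N - 1) a c v + v * T1 (N - 1) a c v) := by
  have h1 := TT_up (N - 1) a c v hc
  have h2 := TT_down (N - 1) (a + 1) c v hc
  rw [h1]
  simp only [T1, T2] at *
  have : a / c * c = a := by field_simp
  linear_combination (-(N : ℝ) * (a / c)) * h2 - N * TT (N - 1) (a + 1) c v * this

noncomputable def bb (B : ℝ) (N : ℕ) : ℝ := (ascPochhammer ℝ N).eval B / (N.factorial : ℝ)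

lemma bb_zero (B : ℝ) : bb B 0 = 1 := by simp [bb]

lemma bb_succ (B : ℝ) (N : ℕ) : ((N : ℝ) + 1) * bb B (N + 1) = (B + N) * bb B N := by
  simp only [bb, ascPochhammer_succ_eval, Nat.factorial_succ]
  push_cast
  have : (N.factorial : ℝ) ≠ 0 := by positivity
  field_simp

lemma bb_shift (B : ℝ) (N : ℕ) : B * bb (B + 1) N = (N + 1) * bb B (N + 1) := by
  induction N with
  | zero => have := bb_succ B 0; simp [bb_zero] at *; linarith
  | succ N ih =>
    have h1 := bb_succ (B + 1) N
    have h2 := bb_succ B (N + 1)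
    push_cast at *
    have : ((N : ℝ) + 1) ≠ 0 := by positivity
    apply mul_left_cancel₀ this
    linear_combination B * h1 - (N+1) * h2 + (B+1+N) * ih

lemma bb_summable (B ρ : ℝ) (hρ : 0 ≤ ρ) (hρ1 : ρ < 1) (k : ℕ) :
    Summable (fun N : ℕ => |bb B N| * ((N : ℝ) + 1) ^ k * ρ ^ N) := by
  obtain ⟨s, hs, hs1⟩ := exists_between hρ1
  apply summable_of_ratio_norm_eventually_le (r := s) hs1
  have hB : ∀ n : ℕ, |bb B (n + 1)| = |B + n| / (n + 1) * |bb B n| := by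
    intro n
    have h := bb_succ B n
    have hn : (0 : ℝ) < n + 1 := by positivity
    have : bb B (n + 1) = (B + n) / (n + 1) * bb B n := by field_simp; linarith
    rw [this, abs_mul, abs_div, abs_of_pos hn]
  have hlim : Tendsto (fun n : ℕ => (|B| + n) / (n + 1) * (((n : ℝ) + 2) / (n + 1)) ^ k * ρ) atTop
      (nhds (1 * 1 ^ k * ρ)) := by
    have h0 : Tendsto (fun n : ℕ => 1 / ((n : ℝ) + 1)) atTop (nhds 0) :=
      tendsto_one_div_add_atTop_nhds_zero_nat
    have h1 : Tendsto (fun n : ℕ => (|B| + n) / ((n : ℝ) + 1)) atTop (nhds 1) := by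
      have := (h0.const_mul (|B| - 1)).const_add 1
      simp only [mul_zero, add_zero] at this
      refine this.congr fun n => ?_
      have hn : (0 : ℝ) < n + 1 := by positivity
      field_simp; ring
    have h2 : Tendsto (fun n : ℕ => ((n : ℝ) + 2) / ((n : ℝ) + 1)) atTop (nhds 1) := by
      have := h0.const_add 1
      simp only [add_zero] at this
      refine this.congr fun n => ?_
      have hn : (0 : ℝ) < n + 1 := by positivity
      field_simp; ring
    exact (h1.mul (h2.pow k)).mul_const ρ
  have := hlim.eventually (gt_mem_nhds (by simpa using hs : 1 * 1 ^ k * ρ < s))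
  filter_upwards [this] with n hn
  rw [Real.norm_of_nonneg (by positivity), Real.norm_of_nonneg (by positivity), hB n]
  have hn0 : (0 : ℝ) < n + 1 := by positivity
  have h3 : |B + n| ≤ |B| + n := by
    have := abs_add_le B (n : ℝ); rwa [abs_of_nonneg (Nat.cast_nonneg n : (0 : ℝ) ≤ n)] at this
  calc |B + n| / (n + 1) * |bb B n| * (((n + 1 : ℕ) : ℝ) + 1) ^ k * ρ ^ (n + 1)
      ≤ (|B| + n) / (n + 1) * |bb B n| * (((n + 1 : ℕ) : ℝ) + 1) ^ k * ρ ^ (n + 1) := by gcongr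
    _ = ((|B| + n) / (n + 1) * (((n : ℝ) + 2) / (n + 1)) ^ k * ρ)
          * (|bb B n| * ((n : ℝ) + 1) ^ k * ρ ^ n) := by
        push_cast
        rw [div_pow, pow_succ]
        have : ((n : ℝ) + 1) ^ k ≠ 0 := by positivity
        field_simp
        ring
    _ ≤ s * _ := by gcongr

lemma bb_hasSum (B ρ : ℝ) (hρ : 0 ≤ ρ) (hρ1 : ρ < 1) :
    HasSum (fun N : ℕ => bb B N * ρ ^ N) ((1 - ρ) ^ (-B)) := by
  have h := (Real.one_div_one_sub_rpow_hasFPowerSeriesOnBall_zero B).hasSum (y := ρ)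
    (by simp [enorm_eq_nnnorm]; rw [← NNReal.coe_lt_coe]; simpa [abs_of_nonneg hρ] using hρ1)
  simp only [zero_add, FormalMultilinearSeries.ofScalars_apply_eq] at h
  rw [Real.rpow_neg (by linarith), ← one_div]
  convert! h using 1
  funext N
  rw [smul_eq_mul]
  congr 1
  have h1 := Ring.factorial_nsmul_multichoose_eq_ascPochhammer B N
  rw [Polynomial.ascPochhammer_smeval_eq_eval] at h1
  have h2 : Ring.choose (B + N - 1) N = Ring.multichoose B N := by
    rw [Ring.choose]; congr 1; ring
  rw [h2, bb, ← h1, nsmul_eq_mul]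
  have : (N.factorial : ℝ) ≠ 0 := by positivity
  field_simp


lemma TT_bound_half (N : ℕ) (a v : ℝ) (ha : -1 ≤ a) (ha0 : a ≤ 0) (hv : 0 ≤ v) (hv2 : v ≤ 2) :
    |TT N a (1/2) v| ≤ 4 * ((N : ℝ) + 1) := by
  induction N with
  | zero => simp [TT_zero]
  | succ N ih =>
    have h1 := TT_bound N (a + 1) (1/2 + 1) v (by linarith) (by linarith) (by norm_num) hv hv2
    rw [TT_succ]
    push_cast
    have h2 : |a / (1/2) * v * TT N (a + 1) (1/2 + 1) v| ≤ 4 := by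
      rw [abs_mul, abs_mul, abs_div, abs_of_nonneg hv, abs_of_nonpos ha0]
      have : |(1/2 : ℝ)| = 1/2 := abs_of_pos (by norm_num)
      rw [this]
      calc -a / (1/2) * v * |TT N (a + 1) (1/2 + 1) v| ≤ 1 / (1/2) * 2 * 1 := by
            gcongr <;> linarith
        _ = 4 := by norm_num
    calc _ ≤ |TT N a (1/2) v| + |a / (1/2) * v * TT N (a + 1) (1/2 + 1) v| := abs_sub _ _
      _ ≤ _ := by linarith

lemma T1_bound_half (N : ℕ) (a v : ℝ) (ha : -1 ≤ a) (ha0 : a ≤ 0) (hv : 0 ≤ v) (hv2 : v ≤ 2) :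
    |T1 N a (1/2) v| ≤ 2 * ((N : ℝ) + 1) := by
  have h1 := TT_bound (N - 1) (a + 1) (1/2 + 1) v (by linarith) (by linarith) (by norm_num) hv hv2
  have h2 : |a / (1/2)| ≤ 2 := by rw [abs_le]; constructor <;> linarith
  have h3 : |(-N : ℝ)| ≤ N + 1 := by rw [abs_neg, Nat.abs_cast]; linarith
  rw [T1, abs_mul, abs_mul]
  calc _ ≤ ((N : ℝ) + 1) * 2 * 1 := by gcongr
    _ = _ := by ring

lemma T2_bound_half (N : ℕ) (a v : ℝ) (ha : -1 ≤ a) (ha0 : a ≤ 0) (hv : 0 ≤ v) (hv2 : v ≤ 2) :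
    |T2 N a (1/2) v| ≤ 2 * ((N : ℝ) + 1) ^ 2 := by
  have h1 := TT_bound (N - 1 - 1) (a + 1 + 1) (1/2 + 1 + 1) v (by linarith) (by linarith)
    (by norm_num) hv hv2
  have h2 : |a / (1/2)| ≤ 2 := by rw [abs_le]; constructor <;> linarith
  have h2' : |(a + 1) / (1/2 + 1)| ≤ 1 := by
    rw [abs_of_nonneg (by apply div_nonneg <;> linarith), div_le_one (by norm_num)]; linarith
  have h3 : |(-N : ℝ)| ≤ N + 1 := by rw [abs_neg, Nat.abs_cast]; linarith
  have h3' : |(-(N - 1 : ℕ) : ℝ)| ≤ N + 1 := by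
    rw [abs_neg, Nat.abs_cast]
    have : ((N - 1 : ℕ) : ℝ) ≤ N := by exact_mod_cast Nat.sub_le N 1
    linarith
  rw [T2, T1, abs_mul, abs_mul, abs_mul, abs_mul]
  calc _ ≤ ((N : ℝ) + 1) * 2 * (((N : ℝ) + 1) * 1 * 1) := by gcongr
    _ = _ := by ring

/-- the chord series and its first two derivatives -/
noncomputable def fS (B a ρ c : ℝ) : ℝ := ∑' N : ℕ, bb B N * ρ ^ N * TT N a (1/2) (c ^ 2)
noncomputable def fS1 (B a ρ c : ℝ) : ℝ :=
  ∑' N : ℕ, bb B N * ρ ^ N * (2 * c * T1 N a (1/2) (c ^ 2))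
noncomputable def fS2 (B a ρ c : ℝ) : ℝ :=
  ∑' N : ℕ, bb B N * ρ ^ N * (2 * T1 N a (1/2) (c ^ 2) + 4 * c ^ 2 * T2 N a (1/2) (c ^ 2))

lemma term_bound {B ρ K y : ℝ} {N k : ℕ} (hρ : 0 ≤ ρ) (hy : |y| ≤ K * ((N : ℝ) + 1) ^ k) :
    ‖bb B N * ρ ^ N * y‖ ≤ K * (|bb B N| * ((N : ℝ) + 1) ^ k * ρ ^ N) := by
  rw [Real.norm_eq_abs, abs_mul, abs_mul, abs_of_nonneg (by positivity : 0 ≤ ρ ^ N)]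
  calc _ ≤ |bb B N| * ρ ^ N * (K * ((N : ℝ) + 1) ^ k) := by gcongr
    _ = _ := by ring

section
variable {B a ρ : ℝ}

lemma sq_two {c : ℝ} (hc : |c| ≤ 5/4) : c ^ 2 ≤ 2 := by
  have := sq_abs c; nlinarith [abs_nonneg c]

lemma b0 (ha : -1 ≤ a) (ha0 : a ≤ 0) {c : ℝ} (hc : |c| ≤ 5/4) (N : ℕ) :
    |TT N a (1/2) (c ^ 2)| ≤ 4 * ((N : ℝ) + 1) ^ 1 := by
  simpa using TT_bound_half N a (c ^ 2) ha ha0 (by positivity) (sq_two hc)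

lemma b1 (ha : -1 ≤ a) (ha0 : a ≤ 0) {c : ℝ} (hc : |c| ≤ 5/4) (N : ℕ) :
    |2 * c * T1 N a (1/2) (c ^ 2)| ≤ 5 * ((N : ℝ) + 1) ^ 1 := by
  have := T1_bound_half N a (c ^ 2) ha ha0 (by positivity) (sq_two hc)
  rw [abs_mul, abs_mul, abs_two, pow_one]
  calc _ ≤ 2 * (5/4) * (2 * ((N : ℝ) + 1)) := by gcongr
    _ = _ := by ring

lemma b2 (ha : -1 ≤ a) (ha0 : a ≤ 0) {c : ℝ} (hc : |c| ≤ 5/4) (N : ℕ) :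
    |2 * T1 N a (1/2) (c ^ 2) + 4 * c ^ 2 * T2 N a (1/2) (c ^ 2)| ≤ 20 * ((N : ℝ) + 1) ^ 2 := by
  have h1 := T1_bound_half N a (c ^ 2) ha ha0 (by positivity) (sq_two hc)
  have h2 := T2_bound_half N a (c ^ 2) ha ha0 (by positivity) (sq_two hc)
  have hN : ((N : ℝ) + 1) ≤ ((N : ℝ) + 1) ^ 2 := by
    have : (0 : ℝ) ≤ N := Nat.cast_nonneg N
    nlinarith
  calc _ ≤ |2 * T1 N a (1/2) (c ^ 2)| + |4 * c ^ 2 * T2 N a (1/2) (c ^ 2)| := abs_add_le _ _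
    _ = 2 * |T1 N a (1/2) (c ^ 2)| + 4 * c ^ 2 * |T2 N a (1/2) (c ^ 2)| := by
      rw [abs_mul, abs_mul, abs_two, abs_of_nonneg (by positivity : 0 ≤ 4 * c ^ 2)]
    _ ≤ 2 * (2 * ((N : ℝ) + 1)) + 4 * 2 * (2 * ((N : ℝ) + 1) ^ 2) := by
      have := sq_two hc
      gcongr
    _ ≤ _ := by linarith


lemma s0 (hρ : 0 ≤ ρ) (hρ1 : ρ < 1) (ha : -1 ≤ a) (ha0 : a ≤ 0) (B : ℝ) {c : ℝ} (hc : |c| ≤ 5/4) :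
    Summable (fun N : ℕ => bb B N * ρ ^ N * TT N a (1/2) (c ^ 2)) :=
  Summable.of_norm_bounded ((bb_summable B ρ hρ hρ1 1).mul_left 4)
    (fun N => term_bound hρ (b0 ha ha0 hc N))

lemma s1 (hρ : 0 ≤ ρ) (hρ1 : ρ < 1) (ha : -1 ≤ a) (ha0 : a ≤ 0) (B : ℝ) {c : ℝ} (hc : |c| ≤ 5/4) :
    Summable (fun N : ℕ => bb B N * ρ ^ N * (2 * c * T1 N a (1/2) (c ^ 2))) :=
  Summable.of_norm_bounded ((bb_summable B ρ hρ hρ1 1).mul_left 5)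
    (fun N => term_bound hρ (b1 ha ha0 hc N))

lemma s2 (hρ : 0 ≤ ρ) (hρ1 : ρ < 1) (ha : -1 ≤ a) (ha0 : a ≤ 0) (B : ℝ) {c : ℝ} (hc : |c| ≤ 5/4) :
    Summable (fun N : ℕ => bb B N * ρ ^ N *
      (2 * T1 N a (1/2) (c ^ 2) + 4 * c ^ 2 * T2 N a (1/2) (c ^ 2))) :=
  Summable.of_norm_bounded ((bb_summable B ρ hρ hρ1 2).mul_left 20)
    (fun N => term_bound hρ (b2 ha ha0 hc N))

lemma fS_hasDerivAt (hρ : 0 ≤ ρ) (hρ1 : ρ < 1) (ha : -1 ≤ a) (ha0 : a ≤ 0) (B : ℝ) {c : ℝ} (hc : c ∈ Set.Ioo (-(5/4) : ℝ) (5/4)) :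
    HasDerivAt (fS B a ρ) (fS1 B a ρ c) c := by
  have hI : ∀ y ∈ Set.Ioo (-(5/4) : ℝ) (5/4), |y| ≤ 5/4 := fun y hy =>
    abs_le.2 ⟨hy.1.le, hy.2.le⟩
  refine hasDerivAt_tsum_of_isPreconnected (t := Set.Ioo (-(5/4) : ℝ) (5/4))
    ((bb_summable B ρ hρ hρ1 1).mul_left 5) isOpen_Ioo isPreconnected_Ioo ?_
    (fun N y hy => term_bound hρ (b1 ha ha0 (hI y hy) N)) hc (s0 hρ hρ1 ha ha0 B (hI c hc)) hc
  intro N y hy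
  have h := (TT_hasDerivAt N a (1/2) (y ^ 2) (by norm_num)).comp y ((hasDerivAt_pow 2 y))
  refine (h.const_mul (bb B N * ρ ^ N)).congr_deriv ?_
  simp; left; ring

lemma fS1_hasDerivAt (hρ : 0 ≤ ρ) (hρ1 : ρ < 1) (ha : -1 ≤ a) (ha0 : a ≤ 0) (B : ℝ) {c : ℝ} (hc : c ∈ Set.Ioo (-(5/4) : ℝ) (5/4)) :
    HasDerivAt (fS1 B a ρ) (fS2 B a ρ c) c := by
  have hI : ∀ y ∈ Set.Ioo (-(5/4) : ℝ) (5/4), |y| ≤ 5/4 := fun y hy =>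
    abs_le.2 ⟨hy.1.le, hy.2.le⟩
  refine hasDerivAt_tsum_of_isPreconnected (t := Set.Ioo (-(5/4) : ℝ) (5/4))
    ((bb_summable B ρ hρ hρ1 2).mul_left 20) isOpen_Ioo isPreconnected_Ioo ?_
    (fun N y hy => term_bound hρ (b2 ha ha0 (hI y hy) N)) hc (s1 hρ hρ1 ha ha0 B (hI c hc)) hc
  intro N y hy
  have h := ((hasDerivAt_id y).const_mul 2).mul
    ((T1_hasDerivAt N a (1/2) (y ^ 2) (by norm_num)).comp y ((hasDerivAt_pow 2 y)))
  refine (h.const_mul (bb B N * ρ ^ N)).congr_deriv ?_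
  simp; left; ring

lemma shift_sum (z : ℕ → ℝ) (hz : Summable z) (hz0 : z 0 = 0) :
    ∑' N, (z (N + 1) - z N) = 0 := by
  have h1 : Summable (fun N => z (N + 1)) := (summable_nat_add_iff 1).2 hz
  rw [h1.tsum_sub hz, hz.tsum_eq_zero_add, hz0]
  ring

lemma fS_lower (hρ : 0 ≤ ρ) (hρ1 : ρ < 1) (ha : -1 ≤ a) (ha0 : a ≤ 0) (B : ℝ) {c : ℝ} (hc : |c| ≤ 5/4) :
    c * fS1 B a ρ c + 2 * B * fS B a ρ c = 2 * (1 - ρ) * B * fS (B + 1) a ρ c := by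
  have e : ∀ N : ℕ, 2 * (((N + 1 : ℕ) : ℝ) * (bb B (N + 1) * ρ ^ (N + 1) * TT N a (1/2) (c ^ 2)))
      - 2 * ((N : ℝ) * (bb B N * ρ ^ N * TT (N - 1) a (1/2) (c ^ 2))) =
      c * (bb B N * ρ ^ N * (2 * c * T1 N a (1/2) (c ^ 2)))
      + 2 * B * (bb B N * ρ ^ N * TT N a (1/2) (c ^ 2))
      - 2 * (1 - ρ) * B * (bb (B + 1) N * ρ ^ N * TT N a (1/2) (c ^ 2)) := by
    intro N
    have h1 := TT_D N a (1/2) (c ^ 2)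
    have h2 := bb_succ B N
    have h3 := bb_shift B N
    push_cast
    rw [pow_succ]
    linear_combination (-2 * bb B N * ρ ^ N) * h1 + 2 * ρ ^ N * TT N a (1/2) (c ^ 2) * h2
      + 2 * (1 - ρ) * ρ ^ N * TT N a (1/2) (c ^ 2) * h3
  have hz : Summable (fun N : ℕ => 2 * ((N : ℝ) * (bb B N * ρ ^ N * TT (N - 1) a (1/2) (c ^ 2)))) := by
    refine Summable.of_norm_bounded ((bb_summable B ρ hρ hρ1 2).mul_left 8) fun N => ?_
    have : |2 * (N : ℝ) * TT (N - 1) a (1/2) (c ^ 2)| ≤ 8 * ((N : ℝ) + 1) ^ 2 := by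
      have h := b0 ha ha0 hc (N - 1)
      have hN : ((N - 1 : ℕ) : ℝ) ≤ N := by exact_mod_cast Nat.sub_le N 1
      rw [abs_mul, abs_mul, abs_two, Nat.abs_cast]
      calc _ ≤ 2 * ((N : ℝ) + 1) * (4 * ((N : ℝ) + 1) ^ 1) := by
            gcongr
            · linarith
            · exact h.trans (by gcongr)
        _ = _ := by ring
    convert! term_bound (B := B) (N := N) hρ this using 2
    ring
  have h0 := shift_sum _ hz (by simp)
  simp only [Nat.add_sub_cancel] at h0
  rw [tsum_congr e] at h0
  have S0 := s0 hρ hρ1 ha ha0 B hc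
  have S1 := s1 hρ hρ1 ha ha0 B hc
  have S0' := s0 hρ hρ1 ha ha0 (B + 1) hc
  rw [((S1.mul_left _).add (S0.mul_left _)).tsum_sub (S0'.mul_left _),
    (S1.mul_left _).tsum_add (S0.mul_left _), tsum_mul_left, tsum_mul_left, tsum_mul_left] at h0
  unfold fS fS1
  linarith

lemma fS_ode (hρ : 0 ≤ ρ) (hρ1 : ρ < 1) (ha : -1 ≤ a) (ha0 : a ≤ 0) (B : ℝ) {c : ℝ} (hc : |c| ≤ 5/4) :
    (1 - ρ + ρ * c ^ 2) * fS2 B a ρ c + ρ * ((1 + 2 * B + 2 * a) * c * fS1 B a ρ c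
      + 4 * a * B * fS B a ρ c) = 0 := by
  have e : ∀ N : ℕ, 4 * (((N + 1 : ℕ) : ℝ) * (bb B (N + 1) * ρ ^ (N + 1) *
        (a * TT N a (1/2) (c ^ 2) + c ^ 2 * T1 N a (1/2) (c ^ 2))))
      - 4 * ((N : ℝ) * (bb B N * ρ ^ N *
        (a * TT (N - 1) a (1/2) (c ^ 2) + c ^ 2 * T1 (N - 1) a (1/2) (c ^ 2)))) =
      (1 - ρ + ρ * c ^ 2) * (bb B N * ρ ^ N *
        (2 * T1 N a (1/2) (c ^ 2) + 4 * c ^ 2 * T2 N a (1/2) (c ^ 2)))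
      + (ρ * (1 + 2 * B + 2 * a) * c) * (bb B N * ρ ^ N * (2 * c * T1 N a (1/2) (c ^ 2)))
      + (ρ * 4 * a * B) * (bb B N * ρ ^ N * TT N a (1/2) (c ^ 2)) := by
    intro N
    have h1 := TT_hyp N a (1/2) (c ^ 2) (by norm_num)
    have h2 := bb_succ B N
    have h3 := TT_D N a (1/2) (c ^ 2)
    have h4 : T1 N a (1/2) (c ^ 2) + c ^ 2 * T2 N a (1/2) (c ^ 2) =
      N * (T1 N a (1/2) (c ^ 2) - T1 (N - 1) a (1/2) (c ^ 2)) := by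
      have d1 := (hasDerivAt_id (c ^ 2)).mul (T1_hasDerivAt N a (1/2) (c ^ 2) (by norm_num))
      have d2 := ((TT_hasDerivAt N a (1/2) (c ^ 2) (by norm_num)).sub
        (TT_hasDerivAt (N - 1) a (1/2) (c ^ 2) (by norm_num))).const_mul (N : ℝ)
      have ee : (id * T1 N a (1/2)) =
          fun y => (N : ℝ) * (TT N a (1/2) - TT (N - 1) a (1/2)) y := by
        funext y
        simpa using TT_D N a (1/2) y
      rw [ee] at d1
      have := d1.unique d2
      simpa using this
    push_cast
    rw [pow_succ]
    linear_combination (4 * ρ ^ N * ρ * (a * TT N a (1/2) (c ^ 2) + c ^ 2 * T1 N a (1/2) (c ^ 2))) * h2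
      - 4 * (1 - ρ) * bb B N * ρ ^ N * h1 - 4 * a * ρ * bb B N * ρ ^ N * h3
      - 4 * ρ * c ^ 2 * bb B N * ρ ^ N * h4
  have hz : Summable (fun N : ℕ => 4 * ((N : ℝ) * (bb B N * ρ ^ N *
        (a * TT (N - 1) a (1/2) (c ^ 2) + c ^ 2 * T1 (N - 1) a (1/2) (c ^ 2))))) := by
    refine Summable.of_norm_bounded ((bb_summable B ρ hρ hρ1 2).mul_left 32) fun N => ?_
    have : |4 * (N : ℝ) * (a * TT (N - 1) a (1/2) (c ^ 2) + c ^ 2 * T1 (N - 1) a (1/2) (c ^ 2))|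
        ≤ 32 * ((N : ℝ) + 1) ^ 2 := by
      have h := b0 ha ha0 hc (N - 1)
      have h' := T1_bound_half (N - 1) a (c ^ 2) ha ha0 (by positivity) (sq_two hc)
      have hN : ((N - 1 : ℕ) : ℝ) ≤ N := by exact_mod_cast Nat.sub_le N 1
      rw [abs_mul, abs_mul, Nat.abs_cast, abs_of_pos (by norm_num : (0 : ℝ) < 4)]
      have h5 : |a * TT (N - 1) a (1/2) (c ^ 2) + c ^ 2 * T1 (N - 1) a (1/2) (c ^ 2)|
          ≤ 8 * ((N : ℝ) + 1) := by
        calc _ ≤ |a * TT (N - 1) a (1/2) (c ^ 2)| + |c ^ 2 * T1 (N - 1) a (1/2) (c ^ 2)| :=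
              abs_add_le _ _
          _ = |a| * |TT (N - 1) a (1/2) (c ^ 2)| + c ^ 2 * |T1 (N - 1) a (1/2) (c ^ 2)| := by
              rw [abs_mul, abs_mul, abs_of_nonneg (by positivity : 0 ≤ c ^ 2)]
          _ ≤ 1 * (4 * (((N - 1 : ℕ) : ℝ) + 1) ^ 1) + 2 * (2 * (((N - 1 : ℕ) : ℝ) + 1)) := by
              have := sq_two hc
              have : |a| ≤ 1 := by rw [abs_le]; constructor <;> linarith
              gcongr
          _ ≤ _ := by linarith
      calc _ ≤ 4 * ((N : ℝ) + 1) * (8 * ((N : ℝ) + 1)) := by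
            gcongr
            linarith
        _ = _ := by ring
    convert! term_bound (B := B) (N := N) hρ this using 2
    ring
  have h0 := shift_sum _ hz (by simp)
  simp only [Nat.add_sub_cancel] at h0
  rw [tsum_congr e] at h0
  have S0 := s0 hρ hρ1 ha ha0 B hc
  have S1 := s1 hρ hρ1 ha ha0 B hc
  have S2 := s2 hρ hρ1 ha ha0 B hc
  rw [((S2.mul_left _).add (S1.mul_left _)).tsum_add (S0.mul_left _),
    (S2.mul_left _).tsum_add (S1.mul_left _), tsum_mul_left, tsum_mul_left, tsum_mul_left] at h0
  unfold fS fS1 fS2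
  linarith

lemma fS_zero (hρ : 0 ≤ ρ) (hρ1 : ρ < 1) (ha : -1 ≤ a) (ha0 : a ≤ 0) (B : ℝ) : fS B a ρ 0 = (1 - ρ) ^ (-B) := by
  rw [← (bb_hasSum B ρ hρ hρ1).tsum_eq]
  simp [fS, TT_at_zero]

lemma fS1_zero (B : ℝ) : fS1 B a ρ 0 = 0 := by
  simp [fS1]

end


lemma taylor_bound (q : ℝ) (hq : 0 < q) (M : ℝ) : ∃ C : ℝ, 0 ≤ C ∧ ∀ y : ℝ, |y| ≤ M →
    |max y 0 ^ q - 1 - q * (y - 1)| ≤ C * (y - 1) ^ 2 := by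
  have h1 := (Real.one_add_rpow_hasFPowerSeriesAt_zero (a := q)).isBigO_sub_partialSum_pow 2
  obtain ⟨K, hK⟩ := h1.bound
  obtain ⟨δ, hδ, hball⟩ := Metric.eventually_nhds_iff.1 hK
  have hcont : ContinuousOn (fun y : ℝ => max y 0 ^ q - 1 - q * (y - 1)) (Set.Icc (-M) M) := by
    apply Continuous.continuousOn
    have : Continuous (fun y : ℝ => max y 0 ^ q) :=
      (continuous_id.max continuous_const).rpow_const (fun _ => Or.inr hq.le)
    fun_prop
  obtain ⟨L, hL⟩ := isCompact_Icc.exists_bound_of_continuousOn hcont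
  set δ' := min δ 1 with hδ'
  have hδ'0 : 0 < δ' := lt_min hδ one_pos
  refine ⟨max |K| (|L| / δ' ^ 2), by positivity, fun y hy => ?_⟩
  by_cases hy1 : |y - 1| < δ'
  · have h2 := hball (y := y - 1) (by simpa using lt_of_lt_of_le hy1 (min_le_left _ _))
    have hy0 : 0 < y := by
      have := (abs_lt.1 (lt_of_lt_of_le hy1 (min_le_right _ _))).1; linarith
    have h3 : (binomialSeries ℝ q).partialSum 2 (y - 1) = 1 + q * (y - 1) := by
      simp [FormalMultilinearSeries.partialSum, Finset.sum_range_succ]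
      have hc (n : ℕ) : (binomialSeries ℝ q).coeff n = Ring.choose q n := by
        rw [FormalMultilinearSeries.coeff, binomialSeries_apply]
        have : (List.ofFn (1 : Fin n → ℝ)).prod = 1 := by rw [List.prod_ofFn]; simp
        simp [this]
      rw [hc, hc, Ring.choose_zero_right, Ring.choose_one_right]
      ring
    rw [h3] at h2
    have h4 : (1 + (0 + (y - 1))) = y := by ring
    rw [max_eq_left hy0.le]
    simp only [h4, Real.norm_eq_abs, abs_pow, abs_abs, sq_abs] at h2
    rw [sub_sub]
    refine h2.trans ?_
    gcongr
    exact (le_abs_self K).trans (le_max_left _ _)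
  · have h2 := hL y (abs_le.1 hy)
    rw [Real.norm_eq_abs] at h2
    push Not at hy1
    have h5 : δ' ^ 2 ≤ (y - 1) ^ 2 := by rw [← sq_abs (y - 1)]; gcongr
    calc _ ≤ |L| := h2.trans (le_abs_self L)
      _ = |L| / δ' ^ 2 * δ' ^ 2 := by field_simp
      _ ≤ _ := by
        gcongr
        exact le_max_right _ _

lemma hasDerivAt_maxpow (p : ℝ) (hp : 1 < p) (y : ℝ) :
    HasDerivAt (fun y : ℝ => max y 0 ^ p) (p * max y 0 ^ (p - 1)) y := by
  rcases lt_trichotomy y 0 with hy | hy | hy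
  · rw [max_eq_right hy.le, Real.zero_rpow (by linarith), mul_zero]
    refine (hasDerivAt_const y (0 : ℝ)).congr_of_eventuallyEq ?_
    filter_upwards [gt_mem_nhds hy] with z hz
    rw [max_eq_right hz.le, Real.zero_rpow (by linarith)]
  · subst hy
    rw [max_self, Real.zero_rpow (by linarith), mul_zero]
    rw [hasDerivAt_iff_isLittleO_nhds_zero]
    simp only [zero_add, max_self, smul_zero, sub_zero, Real.zero_rpow (by linarith : p ≠ 0)]
    rw [Asymptotics.isLittleO_iff]
    intro c hc
    have hcont : Tendsto (fun y : ℝ => |y| ^ (p - 1)) (nhds 0) (nhds 0) := by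
      have : Continuous (fun y : ℝ => |y| ^ (p - 1)) :=
        continuous_abs.rpow_const (fun _ => Or.inr (by linarith))
      simpa [Real.zero_rpow (by linarith : p - 1 ≠ 0)] using this.tendsto 0
    filter_upwards [hcont.eventually (gt_mem_nhds hc)] with z hz
    rw [Real.norm_of_nonneg (by positivity), Real.norm_eq_abs]
    calc max z 0 ^ p ≤ |z| ^ p := by
          gcongr
          exact max_le (le_abs_self z) (abs_nonneg z)
      _ = |z| ^ (p - 1) * |z| := by
          rcases eq_or_ne z 0 with h | h
          · subst h; simp [Real.zero_rpow (by linarith : p ≠ 0)]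
          · rw [← Real.rpow_add_one (by simpa using h)]; ring_nf
      _ ≤ c * |z| := by gcongr
  · rw [max_eq_left hy.le]
    refine (Real.hasDerivAt_rpow_const (Or.inl hy.ne')).congr_of_eventuallyEq ?_
    filter_upwards [lt_mem_nhds hy] with z hz
    rw [max_eq_left hz.le]

noncomputable def Qp (q t r : ℝ) : ℝ := max (1 - 2 * t * r - r ^ 2) 0 ^ q

noncomputable def FF (p t r : ℝ) : ℝ := 2 - Qp p t r - Qp p (-t) r

lemma Qp_continuous (q t : ℝ) (hq : 0 < q) : Continuous (Qp q t) := by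
  unfold Qp
  exact ((by fun_prop : Continuous fun r : ℝ => 1 - 2 * t * r - r ^ 2).max
    continuous_const).rpow_const (fun _ => Or.inr hq.le)

lemma Qp_nonneg (q t r : ℝ) : 0 ≤ Qp q t r := by unfold Qp; positivity

lemma Qp_zero_right (q t : ℝ) : Qp q t 0 = 1 := by simp [Qp]

lemma Qp_mul (q t r : ℝ) (hq : 1 < q) : Qp q t r = (1 - 2 * t * r - r ^ 2) * Qp (q - 1) t r := by
  unfold Qp
  rcases le_or_gt (1 - 2 * t * r - r ^ 2) 0 with h | h
  · rw [max_eq_right h, Real.zero_rpow (by linarith), Real.zero_rpow (by linarith)]; ring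
  · rw [max_eq_left h.le]
    generalize 1 - 2 * t * r - r ^ 2 = x at h
    rw [mul_comm, ← Real.rpow_add_one h.ne', sub_add_cancel]

lemma Qp_vanish {q t r M : ℝ} (hq : 0 < q) (ht : |t| ≤ M) (hr : 2 * M + 1 ≤ r) : Qp q t r = 0 := by
  unfold Qp
  have hM : 0 ≤ M := (abs_nonneg t).trans ht
  have := (abs_le.1 ht).1
  rw [max_eq_right, Real.zero_rpow hq.ne']
  nlinarith

lemma Qp_le {q t r M : ℝ} (hq : 0 < q) (ht : |t| ≤ M) : Qp q t r ≤ (1 + M ^ 2) ^ q := by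
  unfold Qp
  have hM : 0 ≤ M := (abs_nonneg t).trans ht
  have h2 : t ^ 2 ≤ M ^ 2 := by rw [← sq_abs t]; gcongr
  apply Real.rpow_le_rpow (le_max_right _ _) _ hq.le
  apply max_le
  · nlinarith [sq_nonneg (t + r)]
  · positivity

lemma Qp_taylor (q M : ℝ) (hq : 0 < q) : ∃ C : ℝ, 0 ≤ C ∧ ∀ t r : ℝ, |t| ≤ M → 0 ≤ r →
    r ≤ 2 * M + 1 → |Qp q t r - 1 + q * (2 * t * r + r ^ 2)| ≤ C * r ^ 2 := by
  obtain ⟨C, hC, h⟩ := taylor_bound q hq (1 + 2 * M * (2 * M + 1) + (2 * M + 1) ^ 2)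
  refine ⟨C * (4 * M + 1) ^ 2, by positivity, fun t r ht hr hr2 => ?_⟩
  have hM : 0 ≤ M := (abs_nonneg t).trans ht
  have hb : |2 * t * r + r ^ 2| ≤ 2 * M * r + r ^ 2 := by
    calc _ ≤ |2 * t * r| + |r ^ 2| := abs_add_le _ _
      _ = 2 * |t| * r + r ^ 2 := by rw [abs_mul, abs_mul, abs_two, abs_of_nonneg hr, abs_of_nonneg (by positivity : 0 ≤ r ^ 2)]
      _ ≤ _ := by gcongr
  have h1 := h (1 - 2 * t * r - r ^ 2) (by
    have e : 1 - 2 * t * r - r ^ 2 = 1 - (2 * t * r + r ^ 2) := by ring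
    rw [e]
    calc _ ≤ |(1 : ℝ)| + |2 * t * r + r ^ 2| := abs_sub _ _
      _ ≤ 1 + (2 * M * r + r ^ 2) := by rw [abs_one]; gcongr
      _ ≤ 1 + (2 * M * (2 * M + 1) + (2 * M + 1) ^ 2) := by gcongr
      _ = _ := by ring)
  have e2 : Qp q t r - 1 + q * (2 * t * r + r ^ 2) =
    max (1 - 2 * t * r - r ^ 2) 0 ^ q - 1 - q * (1 - 2 * t * r - r ^ 2 - 1) := by unfold Qp; ring
  rw [e2]
  refine h1.trans ?_
  rw [mul_assoc C]
  refine mul_le_mul_of_nonneg_left ?_ hC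
  have e3 : (1 - 2 * t * r - r ^ 2 - 1) ^ 2 = |2 * t * r + r ^ 2| ^ 2 := by rw [sq_abs]; ring
  rw [e3, ← mul_pow]
  gcongr
  refine hb.trans ?_
  nlinarith

lemma FF_bound (p M : ℝ) (hp : 0 < p) : ∃ C : ℝ, 0 ≤ C ∧ ∀ t r : ℝ, |t| ≤ M → 0 ≤ r →
    r ≤ 2 * M + 1 → |FF p t r| ≤ C * r ^ 2 := by
  obtain ⟨C, hC, h⟩ := Qp_taylor p M hp
  refine ⟨2 * C + 2 * p, by positivity, fun t r ht hr hr2 => ?_⟩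
  have h1 := abs_le.1 (h t r ht hr hr2)
  have h2 := abs_le.1 (h (-t) r (by rwa [abs_neg]) hr hr2)
  unfold FF
  have : 0 ≤ p * r ^ 2 := by positivity
  rw [abs_le]; constructor <;> linarith [h1.1, h1.2, h2.1, h2.2]

lemma FF_far {p t r M : ℝ} (hp : 0 < p) (ht : |t| ≤ M) (hr : 2 * M + 1 ≤ r) : FF p t r = 2 := by
  unfold FF
  rw [Qp_vanish hp ht hr, Qp_vanish hp (by rwa [abs_neg]) hr]; ring

lemma dQ_bound (q M : ℝ) (hq : 0 < q) : ∃ C : ℝ, 0 ≤ C ∧ ∀ t r : ℝ, |t| ≤ M → 0 ≤ r →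
    |Qp q t r - Qp q (-t) r| ≤ C * r := by
  obtain ⟨C, hC, h⟩ := Qp_taylor q M hq
  refine ⟨2 * C * |2 * M + 1| + 4 * q * |M|, by positivity, fun t r ht hr => ?_⟩
  have hM : 0 ≤ M := (abs_nonneg t).trans ht
  rw [abs_of_nonneg hM, abs_of_nonneg (by linarith : 0 ≤ 2 * M + 1)]
  rcases le_or_gt r (2 * M + 1) with hr2 | hr2
  · have h1 := h t r ht hr hr2
    have h2 := h (-t) r (by rwa [abs_neg]) hr hr2
    have e : Qp q t r - Qp q (-t) r = (Qp q t r - 1 + q * (2 * t * r + r ^ 2))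
      - (Qp q (-t) r - 1 + q * (2 * (-t) * r + r ^ 2)) - 4 * q * t * r := by ring
    rw [e]
    calc _ ≤ |Qp q t r - 1 + q * (2 * t * r + r ^ 2)|
          + |Qp q (-t) r - 1 + q * (2 * (-t) * r + r ^ 2)| + |4 * q * t * r| :=
          (abs_sub _ _).trans (by gcongr; exact abs_sub _ _)
      _ ≤ C * r ^ 2 + C * r ^ 2 + 4 * q * M * r := by
          gcongr
          rw [abs_mul, abs_mul, abs_of_nonneg hr, abs_of_nonneg (by positivity : 0 ≤ 4 * q)]
          gcongr
      _ = (2 * C * r + 4 * q * M) * r := by ring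
      _ ≤ _ := by gcongr
  · rw [Qp_vanish hq ht hr2.le, Qp_vanish hq (by rwa [abs_neg]) hr2.le]
    simp; positivity

lemma Qp_hasDerivAt_t (p t r : ℝ) (hp : 1 < p) :
    HasDerivAt (fun t => Qp p t r) (-(2 * r * p) * Qp (p - 1) t r) t := by
  have h := (hasDerivAt_maxpow p hp (1 - 2 * t * r - r ^ 2)).comp t
    (((((hasDerivAt_id t).const_mul 2).mul_const r).const_sub 1).sub_const (r ^ 2))
  refine h.congr_deriv ?_
  unfold Qp; simp; ring

lemma Qp_hasDerivAt_r (p t r : ℝ) (hp : 1 < p) :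
    HasDerivAt (fun r => Qp p t r) (-(2 * t + 2 * r) * p * Qp (p - 1) t r) r := by
  have h := (hasDerivAt_maxpow p hp (1 - 2 * t * r - r ^ 2)).comp r
    ((((hasDerivAt_id r).const_mul (2 * t)).const_sub 1).sub (hasDerivAt_pow 2 r))
  refine h.congr_deriv ?_
  unfold Qp; simp; ring

lemma Qp_hasDerivAt_t' (p t r : ℝ) (hp : 1 < p) :
    HasDerivAt (fun t => Qp p (-t) r) ((2 * r * p) * Qp (p - 1) (-t) r) t := by
  have h := (Qp_hasDerivAt_t p (-t) r hp).comp t (hasDerivAt_neg t)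
  refine h.congr_deriv ?_
  ring

noncomputable def Ft (p t r : ℝ) : ℝ := 2 * p * r * (Qp (p - 1) t r - Qp (p - 1) (-t) r)
noncomputable def Fr (p t r : ℝ) : ℝ :=
  p * (2 * t * (Qp (p - 1) t r - Qp (p - 1) (-t) r) + 2 * r * (Qp (p - 1) t r + Qp (p - 1) (-t) r))
noncomputable def Ftt (p t r : ℝ) : ℝ :=
  -(4 * p * (p - 1)) * r ^ 2 * (Qp (p - 2) t r + Qp (p - 2) (-t) r)

lemma FF_hasDerivAt_t (p t r : ℝ) (hp : 1 < p) : HasDerivAt (fun t => FF p t r) (Ft p t r) t := by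
  refine (((Qp_hasDerivAt_t p t r hp).const_sub 2).sub (Qp_hasDerivAt_t' p t r hp)).congr_deriv ?_
  unfold Ft; ring

lemma FF_hasDerivAt_r (p t r : ℝ) (hp : 1 < p) : HasDerivAt (fun r => FF p t r) (Fr p t r) r := by
  refine (((Qp_hasDerivAt_r p t r hp).const_sub 2).sub (Qp_hasDerivAt_r p (-t) r hp)).congr_deriv ?_
  unfold Fr; ring

lemma Ft_hasDerivAt_t (p t r : ℝ) (hp : 2 < p) : HasDerivAt (fun t => Ft p t r) (Ftt p t r) t := by
  refine (((Qp_hasDerivAt_t (p - 1) t r (by linarith)).sub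
    (Qp_hasDerivAt_t' (p - 1) t r (by linarith))).const_mul (2 * p * r)).congr_deriv ?_
  have : p - 1 - 1 = p - 2 := by ring
  unfold Ftt; rw [this]; ring

/-- dominating function -/
noncomputable def bd (α R C r : ℝ) : ℝ := if r ≤ R then C * r ^ (1 - α) else C * r ^ (-1 - α)

lemma bd_integrable (α R C : ℝ) (hα : 0 < α) (hα2 : α < 2) (hR : 0 < R) :
    IntegrableOn (bd α R C) (Set.Ioi 0) := by
  rw [← Set.Ioc_union_Ioi_eq_Ioi hR.le]
  apply IntegrableOn.union
  · have h : IntegrableOn (fun r : ℝ => C * r ^ (1 - α)) (Set.Ioc 0 R) :=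
      ((intervalIntegrable_iff_integrableOn_Ioc_of_le hR.le).1
        (intervalIntegral.intervalIntegrable_rpow' (by linarith))).const_mul C
    exact h.congr_fun (fun r hr => by simp [bd, hr.2]) measurableSet_Ioc
  · have h : IntegrableOn (fun r : ℝ => C * r ^ (-1 - α)) (Set.Ioi R) :=
      (integrableOn_Ioi_rpow_of_lt (by linarith) hR).const_mul C
    exact h.congr_fun (fun r hr => by simp [bd, not_le.2 (Set.mem_Ioi.1 hr)]) measurableSet_Ioi

lemma le_bd {α R C g r : ℝ} (hr : 0 < r) (h1 : r ≤ R → |g| ≤ C * r ^ 2) (h2 : R < r → |g| ≤ C) :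
    ‖g * r ^ (-1 - α)‖ ≤ bd α R C r := by
  rw [Real.norm_eq_abs, abs_mul, abs_of_nonneg (by positivity : 0 ≤ r ^ (-1 - α))]
  unfold bd
  split_ifs with h
  · have e : r ^ (1 - α) = r ^ 2 * r ^ (-1 - α) := by
      rw [← Real.rpow_natCast, ← Real.rpow_add hr]; congr 1; push_cast; ring
    rw [e, ← mul_assoc]
    gcongr
    exact h1 h
  · gcongr
    exact h2 (not_le.1 h)

section
variable {α : ℝ}

lemma FF_continuous (p t : ℝ) (hp : 0 < p) : Continuous (FF p t) := by
  unfold FF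
  have := Qp_continuous p t hp
  have := Qp_continuous p (-t) hp
  fun_prop

lemma Ft_continuous (p t : ℝ) (hp : 1 < p) : Continuous (Ft p t) := by
  unfold Ft
  have := Qp_continuous (p - 1) t (by linarith)
  have := Qp_continuous (p - 1) (-t) (by linarith)
  fun_prop

lemma Fr_continuous (p t : ℝ) (hp : 1 < p) : Continuous (Fr p t) := by
  unfold Fr
  have := Qp_continuous (p - 1) t (by linarith)
  have := Qp_continuous (p - 1) (-t) (by linarith)
  fun_prop

lemma Ftt_continuous (p t : ℝ) (hp : 2 < p) : Continuous (Ftt p t) := by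
  unfold Ftt
  have := Qp_continuous (p - 2) t (by linarith)
  have := Qp_continuous (p - 2) (-t) (by linarith)
  fun_prop

lemma mul_meas (α : ℝ) {g : ℝ → ℝ} (hg : Continuous g) :
    AEStronglyMeasurable (fun r => g r * r ^ (-1 - α)) (volume.restrict (Set.Ioi 0)) := by
  have := hg.measurable
  exact (by fun_prop : Measurable fun r : ℝ => g r * r ^ (-1 - α)).aestronglyMeasurable


lemma integrable_of_bound (hα : 0 < α) (hα2 : α < 2) {g : ℝ → ℝ} (hg : Continuous g) {R C : ℝ} (hR : 0 < R)
    (h1 : ∀ r, 0 < r → r ≤ R → |g r| ≤ C * r ^ 2) (h2 : ∀ r, R < r → |g r| ≤ C) :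
    IntegrableOn (fun r => g r * r ^ (-1 - α)) (Set.Ioi 0) := by
  refine (bd_integrable α R C hα hα2 hR).mono' (mul_meas α hg) ?_
  exact (ae_restrict_mem measurableSet_Ioi).mono fun r hr => le_bd hr (h1 r hr) (h2 r)

lemma FF_bd (hα : 0 < α) (hα2 : α < 2) (p M : ℝ) (hp : 0 < p) : ∃ C : ℝ, ∀ t, |t| ≤ M →
    (∀ r, 0 < r → r ≤ 2 * M + 1 → |FF p t r| ≤ C * r ^ 2) ∧
      (∀ r, 2 * M + 1 < r → |FF p t r| ≤ C) := by
  obtain ⟨C, hC, h⟩ := FF_bound p M hp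
  refine ⟨C + 2, fun t ht => ⟨fun r hr hr2 => (h t r ht hr.le hr2).trans ?_, fun r hr => ?_⟩⟩
  · gcongr; linarith
  · rw [FF_far hp ht hr.le, abs_two]; linarith

lemma FF_integrable (hα : 0 < α) (hα2 : α < 2) (p t : ℝ) (hp : 0 < p) :
    IntegrableOn (fun r => FF p t r * r ^ (-1 - α)) (Set.Ioi 0) := by
  obtain ⟨C, h⟩ := FF_bd hα hα2 p |t| hp
  exact integrable_of_bound hα hα2 (FF_continuous p t hp) (by positivity) (h t le_rfl).1 (h t le_rfl).2

lemma Ft_bd (hα : 0 < α) (hα2 : α < 2) (p M : ℝ) (hp : 1 < p) : ∃ C : ℝ, ∀ t, |t| ≤ M →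
    (∀ r, 0 < r → r ≤ 2 * M + 1 → |Ft p t r| ≤ C * r ^ 2) ∧
      (∀ r, 2 * M + 1 < r → |Ft p t r| ≤ C) := by
  obtain ⟨C, hC, h⟩ := dQ_bound (p - 1) M (by linarith)
  refine ⟨2 * p * C, fun t ht => ⟨fun r hr hr2 => ?_, fun r hr => ?_⟩⟩
  · have := h t r ht hr.le
    unfold Ft
    rw [abs_mul, abs_of_nonneg (by positivity : 0 ≤ 2 * p * r)]
    calc _ ≤ 2 * p * r * (C * r) := by gcongr
      _ = _ := by ring
  · unfold Ft
    rw [Qp_vanish (by linarith) ht hr.le, Qp_vanish (by linarith) (by rwa [abs_neg]) hr.le]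
    simp; positivity

lemma Ftt_bd (hα : 0 < α) (hα2 : α < 2) (p M : ℝ) (hp : 2 < p) : ∃ C : ℝ, ∀ t, |t| ≤ M →
    (∀ r, 0 < r → r ≤ 2 * M + 1 → |Ftt p t r| ≤ C * r ^ 2) ∧
      (∀ r, 2 * M + 1 < r → |Ftt p t r| ≤ C) := by
  have hpp : 0 ≤ p - 1 := by linarith
  refine ⟨4 * p * (p - 1) * (2 * (1 + M ^ 2) ^ (p - 2)), fun t ht => ⟨fun r hr hr2 => ?_, fun r hr => ?_⟩⟩
  · have h1 := Qp_le (r := r) (by linarith : 0 < p - 2) ht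
    have h2 := Qp_le (r := r) (by linarith : 0 < p - 2) (by rwa [abs_neg] : |(-t)| ≤ M)
    have h3 := Qp_nonneg (p - 2) t r
    have h4 := Qp_nonneg (p - 2) (-t) r
    unfold Ftt
    rw [abs_mul, abs_mul, abs_neg, abs_of_nonneg (by positivity : 0 ≤ 4 * p * (p - 1)),
      abs_of_nonneg (by positivity : 0 ≤ r ^ 2), abs_of_nonneg (by positivity)]
    calc _ ≤ 4 * p * (p - 1) * r ^ 2 * (2 * (1 + M ^ 2) ^ (p - 2)) := by gcongr; linarith
      _ = _ := by ring
  · unfold Ftt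
    rw [Qp_vanish (by linarith) ht hr.le, Qp_vanish (by linarith) (by rwa [abs_neg]) hr.le]
    simp; positivity

lemma Frr_bd (hα : 0 < α) (hα2 : α < 2) (p M : ℝ) (hp : 1 < p) : ∃ C : ℝ, ∀ t, |t| ≤ M →
    (∀ r, 0 < r → r ≤ 2 * M + 1 → |r * Fr p t r| ≤ C * r ^ 2) ∧
      (∀ r, 2 * M + 1 < r → |r * Fr p t r| ≤ C) := by
  obtain ⟨C, hC, h⟩ := dQ_bound (p - 1) M (by linarith)
  refine ⟨p * (2 * |M| * C + 4 * (1 + M ^ 2) ^ (p - 1)), fun t ht => ⟨fun r hr hr2 => ?_, fun r hr => ?_⟩⟩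
  · have h1 := Qp_le (r := r) (by linarith : 0 < p - 1) ht
    have h2 := Qp_le (r := r) (by linarith : 0 < p - 1) (by rwa [abs_neg] : |(-t)| ≤ M)
    have h3 := Qp_nonneg (p - 1) t r
    have h4 := Qp_nonneg (p - 1) (-t) r
    have h0 := h t r ht hr.le
    unfold Fr
    rw [abs_mul, abs_mul, abs_of_nonneg hr.le, abs_of_nonneg (by positivity : 0 ≤ p)]
    have h5 : |2 * t * (Qp (p - 1) t r - Qp (p - 1) (-t) r) + 2 * r * (Qp (p - 1) t r + Qp (p - 1) (-t) r)|
        ≤ 2 * |M| * (C * r) + 2 * r * (2 * (1 + M ^ 2) ^ (p - 1)) := by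
      refine (abs_add_le _ _).trans ?_
      have ha : |2 * t| ≤ 2 * |M| := by
        rw [abs_mul, abs_two]
        linarith [ht.trans (le_abs_self M)]
      have hb : |2 * t * (Qp (p - 1) t r - Qp (p - 1) (-t) r)| ≤ 2 * |M| * (C * r) := by
        rw [abs_mul]
        exact mul_le_mul ha h0 (abs_nonneg _) (by positivity)
      have hc : |2 * r * (Qp (p - 1) t r + Qp (p - 1) (-t) r)| ≤
          2 * r * (2 * (1 + M ^ 2) ^ (p - 1)) := by
        rw [abs_of_nonneg (by positivity)]
        exact mul_le_mul_of_nonneg_left (by linarith) (by positivity)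
      exact add_le_add hb hc
    calc _ ≤ r * (p * (2 * |M| * (C * r) + 2 * r * (2 * (1 + M ^ 2) ^ (p - 1)))) := by gcongr
      _ = _ := by ring
  · unfold Fr
    rw [Qp_vanish (by linarith) ht hr.le, Qp_vanish (by linarith) (by rwa [abs_neg]) hr.le]
    simp; positivity

/-- parametric derivative -/
lemma param_deriv (hα : 0 < α) (hα2 : α < 2) {G G' : ℝ → ℝ → ℝ}
    (hG : ∀ t, Continuous (G t)) (hG' : ∀ t, Continuous (G' t))
    (hint : ∀ t, IntegrableOn (fun r => G t r * r ^ (-1 - α)) (Set.Ioi 0))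
    (hd : ∀ t r, HasDerivAt (fun t => G t r) (G' t r) t)
    (hb : ∀ M : ℝ, ∃ C : ℝ, ∀ t, |t| ≤ M →
      (∀ r, 0 < r → r ≤ 2 * M + 1 → |G' t r| ≤ C * r ^ 2) ∧ (∀ r, 2 * M + 1 < r → |G' t r| ≤ C))
    (t : ℝ) : IntegrableOn (fun r => G' t r * r ^ (-1 - α)) (Set.Ioi 0) ∧
    HasDerivAt (fun t => ∫ r in Set.Ioi 0, G t r * r ^ (-1 - α))
      (∫ r in Set.Ioi 0, G' t r * r ^ (-1 - α)) t := by
  obtain ⟨C, hC⟩ := hb (|t| + 1)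
  refine hasDerivAt_integral_of_dominated_loc_of_deriv_le (s := Metric.ball t 1)
    (F := fun t r => G t r * r ^ (-1 - α)) (F' := fun t r => G' t r * r ^ (-1 - α))
    (bound := bd α (2 * (|t| + 1) + 1) C)
    (Metric.ball_mem_nhds t one_pos) (Eventually.of_forall fun s => mul_meas α (hG s)) (hint t)
    (mul_meas α (hG' t)) ?_ (bd_integrable α _ C hα hα2 (by positivity)) ?_
  · refine (ae_restrict_mem measurableSet_Ioi).mono fun r hr s hs => ?_
    have hs' : |s| ≤ |t| + 1 := by
      have : |s - t| < 1 := by simpa [Real.dist_eq] using hs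
      have := abs_sub_abs_le_abs_sub s t
      linarith
    exact le_bd hr ((hC s hs').1 r hr) ((hC s hs').2 r)
  · exact Eventually.of_forall fun r s _ => (hd s r).mul_const _

end

noncomputable def hh (α p t : ℝ) : ℝ := ∫ r in Set.Ioi 0, FF p t r * r ^ (-1 - α)
noncomputable def hh1 (α p t : ℝ) : ℝ := ∫ r in Set.Ioi 0, Ft p t r * r ^ (-1 - α)
noncomputable def hh2 (α p t : ℝ) : ℝ := ∫ r in Set.Ioi 0, Ftt p t r * r ^ (-1 - α)

section
variable {α : ℝ}

lemma Ft_integrable (hα : 0 < α) (hα2 : α < 2) (p t : ℝ) (hp : 1 < p) :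
    IntegrableOn (fun r => Ft p t r * r ^ (-1 - α)) (Set.Ioi 0) :=
  (param_deriv hα hα2 (fun t => FF_continuous p t (by linarith)) (fun t => Ft_continuous p t hp)
    (fun t => FF_integrable hα hα2 p t (by linarith)) (fun t r => FF_hasDerivAt_t p t r hp)
    (fun M => Ft_bd hα hα2 p M hp) t).1

lemma hh_hasDerivAt (hα : 0 < α) (hα2 : α < 2) (p t : ℝ) (hp : 1 < p) : HasDerivAt (hh α p) (hh1 α p t) t :=
  (param_deriv hα hα2 (fun t => FF_continuous p t (by linarith)) (fun t => Ft_continuous p t hp)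
    (fun t => FF_integrable hα hα2 p t (by linarith)) (fun t r => FF_hasDerivAt_t p t r hp)
    (fun M => Ft_bd hα hα2 p M hp) t).2

lemma hh1_hasDerivAt (hα : 0 < α) (hα2 : α < 2) (p t : ℝ) (hp : 2 < p) : HasDerivAt (hh1 α p) (hh2 α p t) t :=
  (param_deriv hα hα2 (fun t => Ft_continuous p t (by linarith)) (fun t => Ftt_continuous p t hp)
    (fun t => Ft_integrable hα hα2 p t (by linarith)) (fun t r => Ft_hasDerivAt_t p t r hp)
    (fun M => Ftt_bd hα hα2 p M hp) t).2

lemma Fr_integrable (hα : 0 < α) (hα2 : α < 2) (p t : ℝ) (hp : 1 < p) :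
    IntegrableOn (fun r => (r * Fr p t r) * r ^ (-1 - α)) (Set.Ioi 0) := by
  obtain ⟨C, h⟩ := Frr_bd hα hα2 p |t| hp
  exact integrable_of_bound hα hα2 (continuous_id.mul (Fr_continuous p t hp)) (by positivity)
    (h t le_rfl).1 (h t le_rfl).2

lemma ibp (hα : 0 < α) (hα2 : α < 2) (p t : ℝ) (hp : 1 < p) :
    ∫ r in Set.Ioi 0, (r * Fr p t r) * r ^ (-1 - α) = α * hh α p t := by
  have hI1 := Fr_integrable hα hα2 p t hp
  have hI2 := FF_integrable hα hα2 p t (by linarith)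
  have hd : ∀ r ∈ Set.Ioi (0 : ℝ), HasDerivAt (fun r => FF p t r * r ^ (-α))
      ((r * Fr p t r) * r ^ (-1 - α) - α * (FF p t r * r ^ (-1 - α))) r := by
    intro r hr
    have hr : 0 < r := hr
    refine ((FF_hasDerivAt_r p t r hp).mul (Real.hasDerivAt_rpow_const (Or.inl hr.ne'))).congr_deriv ?_
    have e1 : r ^ (-α) = r * r ^ (-1 - α) := by
      rw [mul_comm, ← Real.rpow_add_one hr.ne']; ring_nf
    have e2 : (-α - 1) = -1 - α := by ring
    rw [e2, e1]; ring
  have hF0 : FF p t 0 = 0 := by simp [FF, Qp_zero_right]; norm_num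
  have hcont : ContinuousWithinAt (fun r => FF p t r * r ^ (-α)) (Set.Ici 0) 0 := by
    obtain ⟨C, hC, h⟩ := FF_bound p |t| (by linarith)
    change Tendsto _ _ (nhds (FF p t 0 * 0 ^ (-α)))
    rw [hF0, zero_mul]
    have hlim : Tendsto (fun r : ℝ => C * r ^ (2 - α)) (nhdsWithin 0 (Set.Ici 0)) (nhds 0) := by
      have : Continuous (fun r : ℝ => C * r ^ (2 - α)) :=
        continuous_const.mul (continuous_id.rpow_const (fun _ => Or.inr (by linarith)))
      have := this.tendsto 0
      simp only [Real.zero_rpow (by linarith : 2 - α ≠ 0), mul_zero] at this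
      exact this.mono_left nhdsWithin_le_nhds
    refine squeeze_zero_norm' ?_ hlim
    have : ∀ᶠ r in nhdsWithin (0 : ℝ) (Set.Ici 0), r < 1 :=
      nhdsWithin_le_nhds (gt_mem_nhds one_pos)
    filter_upwards [this, self_mem_nhdsWithin] with r hr1 hr0
    rcases eq_or_lt_of_le (Set.mem_Ici.1 hr0) with h0 | h0
    · rw [← h0, hF0]; simp; positivity
    · rw [Real.norm_eq_abs, abs_mul, abs_of_nonneg (by positivity : 0 ≤ r ^ (-α))]
      have e : r ^ (2 - α) = r ^ 2 * r ^ (-α) := by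
        rw [← Real.rpow_natCast, ← Real.rpow_add h0]; congr 1
      rw [e, ← mul_assoc]
      gcongr
      exact h t r le_rfl h0.le (by linarith [abs_nonneg t])
  have htop : Tendsto (fun r => FF p t r * r ^ (-α)) atTop (nhds 0) := by
    have := (tendsto_rpow_neg_atTop hα).const_mul 2
    rw [mul_zero] at this
    refine this.congr' ?_
    filter_upwards [eventually_ge_atTop (2 * |t| + 1)] with r hr
    rw [FF_far (by linarith) le_rfl hr]
  have key := integral_Ioi_of_hasDerivAt_of_tendsto hcont hd (hI1.sub (hI2.const_mul α)) htop
  rw [hF0, integral_sub hI1 (hI2.const_mul α), integral_const_mul] at key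
  unfold hh
  linarith

lemma hh_lower (hα : 0 < α) (hα2 : α < 2) (p t : ℝ) (hp : 1 < p) :
    t * hh1 α p t + (α - 2 * p) * hh α p t = -(2 * p) * hh α (p - 1) t := by
  have hI1 := Fr_integrable hα hα2 p t hp
  have hI2 := FF_integrable hα hα2 p t (by linarith)
  have hI3 := Ft_integrable hα hα2 p t hp
  have hI4 := FF_integrable hα hα2 (p - 1) t (by linarith)
  have h1 := ibp hα hα2 p t hp
  have h2 : t * hh1 α p t + (∫ r in Set.Ioi 0, (r * Fr p t r) * r ^ (-1 - α)) =
      2 * p * hh α p t - 2 * p * hh α (p - 1) t := by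
    unfold hh hh1
    rw [← integral_const_mul, ← integral_const_mul, ← integral_const_mul,
      ← integral_sub (hI2.const_mul _) (hI4.const_mul _), ← integral_add (hI3.const_mul _) hI1]
    congr 1
    funext r
    unfold Ft Fr FF
    rw [Qp_mul p t r hp, Qp_mul p (-t) r hp]
    ring
  linarith

lemma hh_second (hα : 0 < α) (hα2 : α < 2) (p t : ℝ) (hp : 2 < p) :
    hh2 α p t = 2 * p * (t * hh1 α (p - 1) t - α * hh α (p - 1) t) := by
  have hI1 := Fr_integrable hα hα2 (p - 1) t (by linarith)
  have hI3 := Ft_integrable hα hα2 (p - 1) t (by linarith)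
  rw [← ibp hα hα2 (p - 1) t (by linarith)]
  unfold hh2 hh1
  rw [← integral_const_mul, ← integral_sub (hI3.const_mul _) hI1, ← integral_const_mul]
  congr 1
  funext r
  unfold Ftt Ft Fr
  have : p - 1 - 1 = p - 2 := by ring
  rw [this]
  ring

lemma hh_ode (hα : 0 < α) (hα2 : α < 2) (p t : ℝ) (hp : 2 < p) :
    (1 + t ^ 2) * hh2 α p t + (1 - 2 * p) * t * hh1 α p t - α * (α - 2 * p) * hh α p t = 0 := by
  have h1 := hh_lower hα hα2 p t (by linarith)
  have h2 := hh_second hα hα2 p t hp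
  have e : (fun t => t * hh1 α p t + (α - 2 * p) * hh α p t) = fun t => -(2 * p) * hh α (p - 1) t := by
    funext t; exact hh_lower hα hα2 p t (by linarith)
  have d1 : HasDerivAt (fun t => t * hh1 α p t + (α - 2 * p) * hh α p t)
      (1 * hh1 α p t + t * hh2 α p t + (α - 2 * p) * hh1 α p t) t :=
    ((hasDerivAt_id t).mul (hh1_hasDerivAt hα hα2 p t hp)).add
      ((hh_hasDerivAt hα hα2 p t (by linarith)).const_mul _)
  have d2 := (hh_hasDerivAt hα hα2 (p - 1) t (by linarith)).const_mul (-(2 * p))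
  rw [e] at d1
  have h3 := d1.unique d2
  linear_combination h2 + t * h3 - α * h1

lemma hh1_zero (p : ℝ) : hh1 α p 0 = 0 := by
  simp [hh1, Ft]

end


lemma real_beta (u v : ℝ) (hu : 0 < u) (hv : 0 < v) :
    ∫ s in (0 : ℝ)..1, s ^ (u - 1) * (1 - s) ^ (v - 1) =
      Real.Gamma u * Real.Gamma v / Real.Gamma (u + v) := by
  have h := ProbabilityTheory.beta_eq_betaIntegralReal u v hu hv
  unfold ProbabilityTheory.beta at h
  rw [h]
  have : Complex.betaIntegral u v =
      ((∫ s in (0 : ℝ)..1, s ^ (u - 1) * (1 - s) ^ (v - 1) : ℝ) : ℂ) := by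
    rw [Complex.betaIntegral, ← intervalIntegral.integral_ofReal]
    refine intervalIntegral.integral_congr fun s hs => ?_
    rw [Set.uIcc_of_le zero_le_one] at hs
    have h1 : 0 ≤ 1 - s := by linarith [hs.2]
    push_cast
    rw [Complex.ofReal_cpow hs.1, Complex.ofReal_cpow h1]
    push_cast
    rfl
  rw [this, Complex.ofReal_re]

lemma beta_Ioi (u v : ℝ) (hu : 0 < u) (hv : 1 < v) :
    ∫ s in Set.Ioi (0 : ℝ), s ^ (u - 1) * max (1 - s) 0 ^ (v - 1) =
      Real.Gamma u * Real.Gamma v / Real.Gamma (u + v) := by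
  rw [← real_beta u v hu (by linarith), intervalIntegral.integral_of_le zero_le_one]
  rw [setIntegral_eq_of_subset_of_forall_sdiff_eq_zero measurableSet_Ioi
    (Set.Ioc_subset_Ioi_self : Set.Ioc (0:ℝ) 1 ⊆ Set.Ioi 0)]
  · refine setIntegral_congr_fun measurableSet_Ioc fun s hs => ?_
    rw [max_eq_left (by linarith [hs.2])]
  · intro s hs
    have h1 : 1 < s := by
      by_contra h
      exact hs.2 ⟨hs.1, not_lt.1 h⟩
    rw [max_eq_right (by linarith), Real.zero_rpow (by linarith), mul_zero]

noncomputable def Cc (α p : ℝ) : ℝ :=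
  2 / α * (Real.Gamma (p + 1) * Real.Gamma (1 - α / 2) / Real.Gamma (p + 1 - α / 2))

lemma hh_zero {α : ℝ} (hα : 0 < α) (hα2 : α < 2) (p : ℝ) (hp : 1 < p) : hh α p 0 = Cc α p := by
  have h := ibp hα hα2 p 0 hp
  have h1 : ∫ r in Set.Ioi (0:ℝ), (r * Fr p 0 r) * r ^ (-1 - α) =
      2 * p * ∫ s in Set.Ioi (0 : ℝ), s ^ ((1 - α / 2) - 1) * max (1 - s) 0 ^ (p - 1) := by
    rw [← integral_comp_rpow_Ioi_of_pos
      (g := fun s : ℝ => s ^ ((1 - α / 2) - 1) * max (1 - s) 0 ^ (p - 1)) (p := 2) two_pos, ← integral_const_mul]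
    refine setIntegral_congr_fun measurableSet_Ioi fun r hr => ?_
    have hr : 0 < r := hr
    simp only [smul_eq_mul]
    have e1 : (r ^ (2:ℝ)) ^ (1 - α / 2 - 1) = r * r * r ^ (-1 - α) / r := by
      rw [← Real.rpow_mul hr.le]
      have : r * r * r ^ (-1 - α) / r = r ^ (-1 - α) * r := by field_simp
      rw [this, ← Real.rpow_add_one hr.ne']
      congr 1; ring
    have e2 : r ^ ((2:ℝ) - 1) = r := by norm_num
    have e3 : r ^ (2:ℝ) = r ^ 2 := Real.rpow_two r
    rw [e1, e2, e3]
    unfold Fr Qp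
    simp
    field_simp
    ring
  rw [h1, beta_Ioi _ _ (by linarith) hp] at h
  have e : 1 - α / 2 + p = p + 1 - α / 2 := by ring
  rw [e] at h
  unfold Cc
  rw [Real.Gamma_add_one (by linarith)]
  rw [div_mul_eq_mul_div, eq_div_iff hα.ne']
  linear_combination -h

lemma Cc_lower {α : ℝ} (hα : 0 < α) (hα2 : α < 2) (p : ℝ) (hp : 1 < p) :
    (2 * p - α) * Cc α p = 2 * p * Cc α (p - 1) := by
  unfold Cc
  have h1 : Real.Gamma (p + 1) = p * Real.Gamma (p - 1 + 1) := by
    rw [Real.Gamma_add_one (by linarith)]; congr 2; ring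
  have h2 : Real.Gamma (p + 1 - α / 2) = (p - α / 2) * Real.Gamma (p - 1 + 1 - α / 2) := by
    have e : p + 1 - α / 2 = (p - α / 2) + 1 := by ring
    rw [e, Real.Gamma_add_one (by linarith)]; congr 2; ring
  have h3 : p - α / 2 ≠ 0 := by linarith
  rw [h1, h2]
  have h5 : 0 < p * 2 - α := by linarith
  have h4 : Real.Gamma (p - 1 + 1 - α / 2) ≠ 0 := (Real.Gamma_pos_of_pos (by linarith)).ne'
  have : 2 * p - α = 2 * (p - α / 2) := by ring
  rw [this]
  generalize Real.Gamma (p - 1 + 1 - α / 2) = g at h4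
  generalize p - α / 2 = z at h3
  field_simp

lemma ode_match {ρ a α p κ : ℝ} (hρ : 0 ≤ ρ) (hρ1 : ρ < 1) (hα : 0 < α) (hα2 : α < 2)
    (ha : a = -α / 2) (hκ : κ ^ 2 * (1 - ρ) = ρ) (hp : 2 < p) {B : ℝ} (hB : B = α / 2 - p) :
    ∀ c ∈ Set.Ioo (-(5/4) : ℝ) (5/4), hh α p (κ * c) = Cc α p * (1 - ρ) ^ B * fS B a ρ c := by
  have ham : -1 ≤ a := by linarith
  have ha0 : a ≤ 0 := by linarith
  have hpos : ∀ c : ℝ, 0 < 1 - ρ + ρ * c ^ 2 := fun c => by nlinarith [sq_nonneg c]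
  set A : ℝ := Cc α p * (1 - ρ) ^ B with hA
  set v : ℝ → ℝ × ℝ → ℝ × ℝ := fun c y =>
    (y.2, -(ρ * ((1 - 2 * p) * c * y.2 - α * (α - 2 * p) * y.1)) / (1 - ρ + ρ * c ^ 2)) with hv
  set K1 : ℝ := (|1 - 2 * p| * (5/4) + |α * (α - 2 * p)|) / (1 - ρ) with hK1
  have hK1n : 0 ≤ K1 := by
    have : 0 < 1 - ρ := by linarith
    positivity
  have hlip : ∀ c ∈ Set.Ioo (-(5/4) : ℝ) (5/4),
      LipschitzOnWith (Real.toNNReal (max 1 K1)) (v c) Set.univ := by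
    intro c hc
    apply LipschitzOnWith.of_dist_le_mul
    intro y _ z _
    rw [Real.coe_toNNReal _ (by positivity), Prod.dist_eq, dist_eq_norm y z]
    have hy1 : |y.1 - z.1| ≤ ‖y - z‖ := norm_fst_le (y - z)
    have hy2 : |y.2 - z.2| ≤ ‖y - z‖ := norm_snd_le (y - z)
    have hn := norm_nonneg (y - z)
    apply max_le
    · simp only [hv, Real.dist_eq]
      calc _ ≤ 1 * ‖y - z‖ := by linarith
        _ ≤ _ := by gcongr; exact le_max_left _ _
    · simp only [hv, Real.dist_eq]
      have hc1 : |c| ≤ 5/4 := abs_le.2 ⟨hc.1.le, hc.2.le⟩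
      calc _ = |ρ * ((1 - 2 * p) * c * (y.2 - z.2) - α * (α - 2 * p) * (y.1 - z.1))| /
              (1 - ρ + ρ * c ^ 2) := by
            rw [← abs_neg (ρ * _)]
            nth_rewrite 3 [← abs_of_pos (hpos c)]
            rw [← abs_div]
            congr 1
            rw [← sub_div]; congr 1; ring
        _ ≤ ((|1 - 2 * p| * (5/4) + |α * (α - 2 * p)|) * ‖y - z‖) / (1 - ρ) := by
            have h1 : |ρ * ((1 - 2 * p) * c * (y.2 - z.2) - α * (α - 2 * p) * (y.1 - z.1))| ≤
              (|1 - 2 * p| * (5/4) + |α * (α - 2 * p)|) * ‖y - z‖ := by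
              rw [abs_mul, abs_of_nonneg hρ]
              calc _ ≤ 1 * |(1 - 2 * p) * c * (y.2 - z.2) - α * (α - 2 * p) * (y.1 - z.1)| := by
                    gcongr
                _ ≤ |(1 - 2 * p) * c * (y.2 - z.2)| + |α * (α - 2 * p) * (y.1 - z.1)| := by
                    rw [one_mul]; exact abs_sub _ _
                _ = |1 - 2 * p| * |c| * |y.2 - z.2| + |α * (α - 2 * p)| * |y.1 - z.1| := by
                    rw [abs_mul, abs_mul, abs_mul (α * (α - 2 * p))]
                _ ≤ |1 - 2 * p| * (5/4) * ‖y - z‖ + |α * (α - 2 * p)| * ‖y - z‖ := by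
                    gcongr
                _ = _ := by ring
            have h2 : 1 - ρ ≤ 1 - ρ + ρ * c ^ 2 := by nlinarith [sq_nonneg c]
            have h3 : 0 < 1 - ρ := by linarith
            gcongr
        _ = K1 * ‖y - z‖ := by rw [hK1]; ring
        _ ≤ _ := by gcongr; exact le_max_right _ _
  have hf : ∀ c ∈ Set.Ioo (-(5/4) : ℝ) (5/4),
      HasDerivAt (fun c => (hh α p (κ * c), κ * hh1 α p (κ * c)))
        (v c (hh α p (κ * c), κ * hh1 α p (κ * c))) c ∧
      (hh α p (κ * c), κ * hh1 α p (κ * c)) ∈ (Set.univ : Set (ℝ × ℝ)) := by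
    intro c hc
    refine ⟨?_, Set.mem_univ _⟩
    have hk : HasDerivAt (fun c : ℝ => κ * c) κ c := by
      simpa using (hasDerivAt_id c).const_mul κ
    have h1 := (hh_hasDerivAt hα hα2 p (κ * c) (by linarith)).comp c hk
    have h2 := ((hh1_hasDerivAt hα hα2 p (κ * c) hp).comp c hk).const_mul κ
    refine (h1.prodMk h2).congr_deriv ?_
    have hode := hh_ode hα hα2 p (κ * c) hp
    rw [hv]
    ext
    · simp; ring
    · simp only
      rw [eq_div_iff (hpos c).ne']
      linear_combination ρ * hode + hh2 α p (κ * c) * hκ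
  have hg : ∀ c ∈ Set.Ioo (-(5/4) : ℝ) (5/4),
      HasDerivAt (fun c => (A * fS B a ρ c, A * fS1 B a ρ c))
        (v c (A * fS B a ρ c, A * fS1 B a ρ c)) c ∧
      (A * fS B a ρ c, A * fS1 B a ρ c) ∈ (Set.univ : Set (ℝ × ℝ)) := by
    intro c hc
    refine ⟨?_, Set.mem_univ _⟩
    have h1 := (fS_hasDerivAt hρ hρ1 ham ha0 B hc).const_mul A
    have h2 := (fS1_hasDerivAt hρ hρ1 ham ha0 B hc).const_mul A
    refine (h1.prodMk h2).congr_deriv ?_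
    have hode := fS_ode hρ hρ1 ham ha0 B (abs_le.2 ⟨hc.1.le, hc.2.le⟩)
    rw [hv]
    ext
    · rfl
    · simp only
      rw [eq_div_iff (hpos c).ne']
      rw [ha, hB] at *
      linear_combination A * hode
  have h0 : (fun c => (hh α p (κ * c), κ * hh1 α p (κ * c))) 0 =
      (fun c => (A * fS B a ρ c, A * fS1 B a ρ c)) 0 := by
    simp only [mul_zero, hh1_zero, fS_zero hρ hρ1 ham ha0 B, fS1_zero, hh_zero hα hα2 p (by linarith)]
    rw [hA, mul_assoc, ← Real.rpow_add (by linarith)]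
    simp
  have key := ODE_solution_unique_of_mem_Ioo hlip (t₀ := 0) (by norm_num) hf hg h0
  intro c hc
  have := key hc
  exact (Prod.mk.inj this).1

lemma lower_match {ρ a α p κ : ℝ} (hρ : 0 ≤ ρ) (hρ1 : ρ < 1) (hα : 0 < α) (hα2 : α < 2)
    (ha : a = -α / 2) (hp : 1 < p) {B : ℝ} (hB : B = α / 2 - p)
    (h : ∀ c ∈ Set.Ioo (-(5/4) : ℝ) (5/4), hh α p (κ * c) = Cc α p * (1 - ρ) ^ B * fS B a ρ c) :
    ∀ c ∈ Set.Ioo (-(5/4) : ℝ) (5/4),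
      hh α (p - 1) (κ * c) = Cc α (p - 1) * (1 - ρ) ^ (B + 1) * fS (B + 1) a ρ c := by
  intro c hc
  have ham : -1 ≤ a := by linarith
  have ha0 : a ≤ 0 := by linarith
  have hk : HasDerivAt (fun c : ℝ => κ * c) κ c := by
    simpa using (hasDerivAt_id c).const_mul κ
  have h1 := (hh_hasDerivAt hα hα2 p (κ * c) hp).comp c hk
  have h2 := (fS_hasDerivAt hρ hρ1 ham ha0 B hc).const_mul (Cc α p * (1 - ρ) ^ B)
  have h3 : HasDerivAt (hh α p ∘ fun c => κ * c) (Cc α p * (1 - ρ) ^ B * fS1 B a ρ c) c := by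
    refine h2.congr_of_eventuallyEq ?_
    filter_upwards [isOpen_Ioo.mem_nhds hc] with z hz using h z hz
  have h4 := h1.unique h3
  have h5 := hh_lower hα hα2 p (κ * c) hp
  have h6 := fS_lower hρ hρ1 ham ha0 B (abs_le.2 ⟨hc.1.le, hc.2.le⟩)
  have h7 := h c hc
  have h8 := Cc_lower hα hα2 p hp
  have h9 : (1 - ρ) ^ (B + 1) = (1 - ρ) ^ B * (1 - ρ) := Real.rpow_add_one (by linarith) _
  rw [h9]
  have hpp : (2 * p) ≠ 0 := by linarith
  apply mul_left_cancel₀ hpp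
  rw [h7] at h5
  subst hB
  linear_combination h5 - c * h4 - Cc α p * (1 - ρ) ^ (α / 2 - p) * h6
    + ((1 - ρ) ^ (α / 2 - p) * (1 - ρ) * fS (α / 2 - p + 1) a ρ c) * h8

lemma hh_eq {ρ α p κ : ℝ} (hρ : 0 ≤ ρ) (hρ1 : ρ < 1) (hα : 0 < α) (hα2 : α < 2)
    (hκ : κ ^ 2 * (1 - ρ) = ρ) (hp : 0 < p) :
    ∀ c ∈ Set.Ioo (-(5/4) : ℝ) (5/4), hh α p (κ * c) =
      Cc α p * (1 - ρ) ^ (α / 2 - p) * fS (α / 2 - p) (-α / 2) ρ c := by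
  have h1 := ode_match hρ hρ1 hα hα2 rfl hκ (by linarith : 2 < p + 2) rfl
  have h2 := lower_match hρ hρ1 hα hα2 rfl (by linarith : 1 < p + 2) rfl h1
  have e : α / 2 - (p + 2) + 1 = α / 2 - (p + 2 - 1) := by ring
  rw [e] at h2
  have h3 := lower_match hρ hρ1 hα hα2 rfl (by linarith : 1 < p + 2 - 1) rfl h2
  have e1 : p + 2 - 1 - 1 = p := by ring
  have e2 : α / 2 - (p + 2 - 1) + 1 = α / 2 - p := by ring
  rw [e1, e2] at h3
  exact h3


section polar
variable {n : ℕ}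

local notation "EE" => EuclideanSpace ℝ (Fin (n + 1))

lemma polar (G : EE → ℝ) (hG : Integrable G) :
    ∫ y, G y = ∫ θ, (∫ r in Set.Ioi (0 : ℝ), r ^ n * G (r • (θ : EE)))
      ∂((volume : Measure EE).toSphere) := by
  have hdim : Module.finrank ℝ EE - 1 = n := by simp
  have hmp := (volume : Measure EE).measurePreserving_homeomorphUnitSphereProd
  rw [hdim] at hmp
  have hemb := (homeomorphUnitSphereProd EE).measurableEmbedding
  set g : (Metric.sphere (0 : EE) 1) × (Set.Ioi (0 : ℝ)) → ℝ := fun z => G (z.2.1 • (z.1 : EE)) with hg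
  have hcomp : g ∘ (homeomorphUnitSphereProd EE) = fun x : ({(0)}ᶜ : Set EE) => G x.1 := by
    funext x
    have hx : ‖(x : EE)‖ ≠ 0 := norm_ne_zero_iff.2 x.2
    simp [hg, smul_smul, hx]
  have hGi : Integrable (fun x : ({(0)}ᶜ : Set EE) => G x.1) ((volume : Measure EE).comap (↑)) := by
    have := (integrableOn_iff_comap_subtypeVal (measurableSet_singleton (0 : EE)).compl (f := G)
      (μ := volume)).1 hG.integrableOn
    exact this
  calc ∫ y, G y = ∫ x : ({(0)}ᶜ : Set EE), G x.1 ∂((volume : Measure EE).comap (↑)) := by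
        rw [integral_subtype_comap (measurableSet_singleton _).compl fun x ↦ G x,
          restrict_compl_singleton]
    _ = ∫ z, g z ∂((volume : Measure EE).toSphere.prod (.volumeIoiPow n)) := by
        rw [← hmp.integral_comp hemb g]
        exact congrArg (fun h : ({(0)}ᶜ : Set EE) → ℝ => ∫ x, h x ∂((volume : Measure EE).comap (↑))) hcomp.symm
    _ = ∫ θ, (∫ r : Set.Ioi (0 : ℝ), g (θ, r) ∂(.volumeIoiPow n))
          ∂((volume : Measure EE).toSphere) := by
        apply integral_prod
        rw [← hmp.integrable_comp_emb hemb, hcomp]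
        exact hGi
    _ = _ := by
        congr 1
        funext θ
        simp only [Measure.volumeIoiPow, ENNReal.ofReal]
        rw [integral_withDensity_eq_integral_smul]
        · rw [integral_subtype_comap measurableSet_Ioi
            fun a ↦ Real.toNNReal (a ^ n) • G (a • (θ : EE))]
          refine setIntegral_congr_fun measurableSet_Ioi fun x hx ↦ ?_
          rw [NNReal.smul_def, Real.coe_toNNReal _ (pow_nonneg (le_of_lt hx) _), smul_eq_mul]
        · exact (measurable_subtype_coe.pow_const _).real_toNNReal

noncomputable def mom (e : EE) (j : ℕ) : ℝ :=
  ∫ θ, (inner ℝ e (θ : EE)) ^ (2 * j) ∂((volume : Measure EE).toSphere)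

lemma gauss1 (j : ℕ) : ∫ s : ℝ, s ^ (2 * j) * Real.exp (-s ^ 2) = Real.Gamma (1 / 2 + j) := by
  have h := integral_comp_abs (f := fun s => s ^ (2 * j) * Real.exp (-s ^ 2))
  simp only [sq_abs, pow_mul] at h ⊢
  rw [h]
  have h2 := integral_rpow_mul_exp_neg_rpow (p := 2) (q := 2 * (j : ℝ)) two_pos
    (by have : (0:ℝ) ≤ j := Nat.cast_nonneg j
        linarith)
  have e : ∫ x in Set.Ioi (0:ℝ), (x ^ 2) ^ j * Real.exp (-x ^ 2) =
      ∫ x in Set.Ioi (0:ℝ), x ^ (2 * (j : ℝ)) * Real.exp (-x ^ (2 : ℝ)) := by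
    refine setIntegral_congr_fun measurableSet_Ioi fun x hx => ?_
    have hx : (0 : ℝ) < x := hx
    rw [Real.rpow_mul hx.le, Real.rpow_two, Real.rpow_natCast]
  rw [e, h2]
  rw [← mul_assoc]; norm_num; congr 1; ring

lemma gauss1_int (j : ℕ) : Integrable (fun s : ℝ => s ^ (2 * j) * Real.exp (-s ^ 2)) := by
  have h := integrable_rpow_mul_exp_neg_mul_sq one_pos (s := ((2 * j : ℕ) : ℝ))
    (by have : (0:ℝ) ≤ ((2 * j : ℕ) : ℝ) := Nat.cast_nonneg _
        linarith)
  simpa only [Real.rpow_natCast, neg_mul, one_mul] using h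

lemma gaussE (e : EE) (he : ‖e‖ = 1) (j : ℕ) :
    Integrable (fun y : EE => (inner ℝ e y) ^ (2 * j) * Real.exp (-‖y‖ ^ 2)) ∧
    ∫ y : EE, (inner ℝ e y) ^ (2 * j) * Real.exp (-‖y‖ ^ 2) =
      Real.Gamma (1 / 2 + j) * Real.Gamma (1 / 2) ^ n := by
  have hv : Orthonormal ℝ (Set.domRestrict ({0} : Set (Fin (n + 1))) (fun _ => e)) := by
    constructor
    · intro i; simpa using he
    · intro i k hik
      exact absurd (Subsingleton.elim i k) hik
  obtain ⟨b, hb⟩ := hv.exists_orthonormalBasis_extension_of_card_eq (by simp)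
  have hb0 : b 0 = e := hb 0 rfl
  set φ : Fin (n + 1) → ℝ → ℝ := fun i s => (if i = 0 then s ^ (2 * j) else 1) * Real.exp (-s ^ 2) with hφ
  set Φ : (Fin (n + 1) → ℝ) → ℝ := fun z => ∏ i, φ i (z i) with hΦ
  have hφ0 : φ 0 = fun s => s ^ (2 * j) * Real.exp (-s ^ 2) := by simp [hφ]
  have hφs : ∀ i : Fin n, φ i.succ = fun s => s ^ (2 * 0) * Real.exp (-s ^ 2) := by
    intro i; simp [hφ]
  have hmp : MeasurePreserving (fun y : EE => (MeasurableEquiv.toLp 2 (Fin (n + 1) → ℝ)).symm (b.repr y))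
      volume volume :=
    (EuclideanSpace.volume_preserving_symm_measurableEquiv_toLp (Fin (n + 1))).comp
      b.measurePreserving_repr
  have hemb : MeasurableEmbedding
      (fun y : EE => (MeasurableEquiv.toLp 2 (Fin (n + 1) → ℝ)).symm (b.repr y)) :=
    (MeasurableEquiv.measurableEmbedding _).comp b.repr.toHomeomorph.measurableEmbedding
  have hfun : (fun y : EE => (inner ℝ e y) ^ (2 * j) * Real.exp (-‖y‖ ^ 2)) =
      Φ ∘ (fun y : EE => (MeasurableEquiv.toLp 2 (Fin (n + 1) → ℝ)).symm (b.repr y)) := by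
    funext y
    have h1 : inner ℝ e y = (b.repr y).ofLp 0 := by rw [b.repr_apply_apply, hb0]
    have h2 : ‖y‖ ^ 2 = ∑ i, (b.repr y).ofLp i ^ 2 := by
      rw [← b.repr.norm_map y, EuclideanSpace.norm_sq_eq]
      simp
    rw [h1, h2, ← Finset.sum_neg_distrib, Real.exp_sum]
    simp only [hΦ, hφ, Function.comp]
    rw [Finset.prod_mul_distrib]
    congr 1
    rw [Finset.prod_ite_eq' Finset.univ (0 : Fin (n + 1))]
    simp
  have hΦi : Integrable Φ := by
    apply Integrable.fintype_prod
    intro i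
    refine Fin.cases ?_ (fun i => ?_) i
    · rw [hφ0]; exact gauss1_int j
    · rw [hφs]; exact gauss1_int 0
  constructor
  · rw [hfun]
    exact (hmp.integrable_comp_emb hemb).2 hΦi
  · rw [hfun]
    have := hmp.integral_comp hemb Φ
    refine Eq.trans this ?_
    rw [hΦ, integral_fintype_prod_volume_eq_prod, Fin.prod_univ_succ]
    rw [hφ0, gauss1]
    congr 1
    simp only [hφs, gauss1]
    simp

lemma mom_eq (e : EE) (he : ‖e‖ = 1) (j : ℕ) :
    mom e j * (Real.Gamma (((n + 1 : ℕ) : ℝ) / 2 + j) / 2) =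
      Real.Gamma (1 / 2 + j) * Real.Gamma (1 / 2) ^ n := by
  obtain ⟨h1, h2⟩ := gaussE e he j
  rw [← h2, polar _ h1]
  unfold mom
  rw [← integral_mul_const]
  congr 1
  funext θ
  have hθ : ‖(θ : EE)‖ = 1 := by simp
  have h3 := integral_rpow_mul_exp_neg_rpow (p := 2) (q := ((n + 2 * j : ℕ) : ℝ)) two_pos
    (by have : (0:ℝ) ≤ ((n + 2 * j : ℕ) : ℝ) := Nat.cast_nonneg _
        linarith)
  have h4 : Real.Gamma (((n + 1 : ℕ) : ℝ) / 2 + j) / 2 =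
      1 / 2 * Real.Gamma ((((n + 2 * j : ℕ) : ℝ) + 1) / 2) := by
    rw [div_eq_inv_mul, one_div]; congr 2; push_cast; ring
  rw [h4, ← h3, ← integral_const_mul]
  refine setIntegral_congr_fun measurableSet_Ioi fun r hr => ?_
  have hr : (0 : ℝ) < r := hr
  rw [inner_smul_right, norm_smul, hθ, mul_one, Real.norm_eq_abs, sq_abs, Real.rpow_natCast,
    Real.rpow_two]
  ring

lemma mom_succ (e : EE) (he : ‖e‖ = 1) (j : ℕ) :
    mom e (j + 1) * (((n + 1 : ℕ) : ℝ) / 2 + j) = mom e j * (1 / 2 + j) := by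
  have h1 := mom_eq e he j
  have h2 := mom_eq e he (j + 1)
  have hj : (0 : ℝ) ≤ j := Nat.cast_nonneg j
  have hD : (0 : ℝ) < ((n + 1 : ℕ) : ℝ) / 2 + j := by positivity
  have e1 : ((n + 1 : ℕ) : ℝ) / 2 + ((j + 1 : ℕ) : ℝ) = (((n + 1 : ℕ) : ℝ) / 2 + j) + 1 := by
    push_cast; ring
  have e2 : (1 : ℝ) / 2 + ((j + 1 : ℕ) : ℝ) = (1 / 2 + j) + 1 := by push_cast; ring
  rw [e1, e2, Real.Gamma_add_one hD.ne', Real.Gamma_add_one (by positivity)] at h2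
  have hg := (Real.Gamma_pos_of_pos hD).ne'
  apply mul_right_cancel₀ hg
  linear_combination 2 * h2 - 2 * (1 / 2 + (j : ℝ)) * h1

lemma mom_zero (e : EE) (he : ‖e‖ = 1) :
    mom e 0 = 2 * Real.pi ^ (((n + 1 : ℕ) : ℝ) / 2) / Real.Gamma (((n + 1 : ℕ) : ℝ) / 2) := by
  have h1 := mom_eq e he 0
  have hD : (0 : ℝ) < ((n + 1 : ℕ) : ℝ) / 2 := by positivity
  have hg := (Real.Gamma_pos_of_pos hD).ne'
  simp only [Nat.cast_zero, add_zero] at h1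
  rw [eq_div_iff hg]
  have : Real.pi ^ (((n + 1 : ℕ) : ℝ) / 2) = Real.Gamma (1 / 2) * Real.Gamma (1 / 2) ^ n := by
    rw [← pow_succ', Real.Gamma_one_half_eq, Real.sqrt_eq_rpow, ← Real.rpow_natCast,
      ← Real.rpow_mul Real.pi_pos.le]
    congr 1; ring
  rw [this]
  linarith

lemma poch_left (c : ℝ) (N : ℕ) :
    c * (ascPochhammer ℝ N).eval (c + 1) = (ascPochhammer ℝ N).eval c * (c + N) := by
  rw [← ascPochhammer_succ_eval, ascPochhammer_succ_left]
  simp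

lemma TT_continuous (N : ℕ) (a c : ℝ) (hc : 0 < c) : Continuous (TT N a c) :=
  continuous_iff_continuousAt.2 fun v => (TT_hasDerivAt N a c v hc).continuousAt

lemma sphere_int {f : ℝ → ℝ} (hf : Continuous f) (e : EE) :
    Integrable (fun θ : Metric.sphere (0 : EE) 1 => f (inner ℝ e (θ : EE)))
      ((volume : Measure EE).toSphere) := by
  have : Continuous (fun θ : Metric.sphere (0 : EE) 1 => f (inner ℝ e (θ : EE))) := by fun_prop
  exact this.integrable_of_hasCompactSupport (HasCompactSupport.of_compactSpace _)

lemma TT_moment (e : EE) (he : ‖e‖ = 1) (N : ℕ) : ∀ (a : ℝ) (j : ℕ),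
    ∫ θ, (inner ℝ e (θ : EE)) ^ (2 * j) * TT N a (1 / 2 + j) ((inner ℝ e (θ : EE)) ^ 2)
      ∂((volume : Measure EE).toSphere) =
    mom e j * ((ascPochhammer ℝ N).eval (((n + 1 : ℕ) : ℝ) / 2 + j - a) /
      (ascPochhammer ℝ N).eval (((n + 1 : ℕ) : ℝ) / 2 + j)) := by
  induction N with
  | zero => intro a j; simp [TT_zero, mom]
  | succ N ih =>
    intro a j
    have hcj : (0 : ℝ) < 1 / 2 + j := by positivity
    have hcj' : (0 : ℝ) < 1 / 2 + ((j + 1 : ℕ) : ℝ) := by positivity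
    have hD : (0 : ℝ) < ((n + 1 : ℕ) : ℝ) / 2 + j := by positivity
    have h1 := ih a j
    have h2 := ih (a + 1) (j + 1)
    have i1 := sphere_int (f := fun s => s ^ (2 * j) * TT N a (1 / 2 + j) (s ^ 2))
      (by have := TT_continuous N a _ hcj; fun_prop) e
    have i2 := sphere_int (f := fun s => s ^ (2 * (j + 1)) *
      TT N (a + 1) (1 / 2 + ((j + 1 : ℕ) : ℝ)) (s ^ 2))
      (by have := TT_continuous N (a + 1) _ hcj'; fun_prop) e
    have hfun : ∀ θ : Metric.sphere (0 : EE) 1,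
        (inner ℝ e (θ : EE)) ^ (2 * j) * TT (N + 1) a (1 / 2 + j) ((inner ℝ e (θ : EE)) ^ 2) =
        (inner ℝ e (θ : EE)) ^ (2 * j) * TT N a (1 / 2 + j) ((inner ℝ e (θ : EE)) ^ 2) -
        (a / (1 / 2 + j)) * ((inner ℝ e (θ : EE)) ^ (2 * (j + 1)) *
          TT N (a + 1) (1 / 2 + ((j + 1 : ℕ) : ℝ)) ((inner ℝ e (θ : EE)) ^ 2)) := by
      intro θ
      rw [TT_succ]
      have : (1 : ℝ) / 2 + ((j + 1 : ℕ) : ℝ) = 1 / 2 + j + 1 := by push_cast; ring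
      rw [this]; ring
    simp only [hfun]
    rw [integral_sub i1 (i2.const_mul _), integral_const_mul, h1, h2]
    have e1 : ((n + 1 : ℕ) : ℝ) / 2 + ((j + 1 : ℕ) : ℝ) - (a + 1) = ((n + 1 : ℕ) : ℝ) / 2 + j - a := by
      push_cast; ring
    have e2 : ((n + 1 : ℕ) : ℝ) / 2 + ((j + 1 : ℕ) : ℝ) = (((n + 1 : ℕ) : ℝ) / 2 + j) + 1 := by
      push_cast; ring
    have hm := mom_succ e he j
    have hp := poch_left (((n + 1 : ℕ) : ℝ) / 2 + j) N
    have hP1 := (ascPochhammer_pos N _ hD).ne'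
    have hP2 := (ascPochhammer_pos N (((n + 1 : ℕ) : ℝ) / 2 + j + 1) (by linarith)).ne'
    rw [e1, e2, ascPochhammer_succ_eval, ascPochhammer_succ_eval]
    generalize ((n + 1 : ℕ) : ℝ) / 2 + (j : ℝ) = D at *
    have hm' : mom e (j + 1) = mom e j * (1 / 2 + j) / D := by
      rw [eq_div_iff hD.ne']; exact hm
    have hDN : D + N ≠ 0 := by positivity
    have hp' : (ascPochhammer ℝ N).eval (D + 1) = (ascPochhammer ℝ N).eval D * (D + N) / D := by
      rw [eq_div_iff hD.ne']; linarith
    rw [hm', hp']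
    generalize (1 : ℝ) / 2 + (j : ℝ) = c at *
    field_simp
    ring

end polar


section pv
variable {n : ℕ}

local notation "EE" => EuclideanSpace ℝ (Fin (n + 1))

lemma fS_sphere (e : EE) (he : ‖e‖ = 1) {ρ a B : ℝ} (hρ : 0 ≤ ρ) (hρ1 : ρ < 1) (ha : -1 ≤ a)
    (ha0 : a ≤ 0) :
    ∫ θ, fS B a ρ (inner ℝ e (θ : EE)) ∂((volume : Measure EE).toSphere) =
      mom e 0 * hyp2F1 (((n + 1 : ℕ) : ℝ) / 2 - a) B (((n + 1 : ℕ) : ℝ) / 2) ρ := by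
  set σ := (volume : Measure EE).toSphere with hσ
  set F : ℕ → Metric.sphere (0 : EE) 1 → ℝ := fun N θ =>
    bb B N * ρ ^ N * TT N a (1/2) ((inner ℝ e (θ : EE)) ^ 2) with hF
  have hc : ∀ θ : Metric.sphere (0 : EE) 1, |inner ℝ e (θ : EE)| ≤ 5/4 := by
    intro θ
    have := abs_real_inner_le_norm e (θ : EE)
    have hθ : ‖(θ : EE)‖ = 1 := by simp
    rw [he, hθ] at this
    linarith
  have hFi : ∀ N, Integrable (F N) σ := by
    intro N
    exact sphere_int (f := fun s => bb B N * ρ ^ N * TT N a (1/2) (s ^ 2))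
      (by have := TT_continuous N a (1/2) (by norm_num); fun_prop) e
  have hbound : ∀ N θ, ‖F N θ‖ ≤ 4 * (|bb B N| * ((N : ℝ) + 1) ^ 1 * ρ ^ N) := by
    intro N θ
    have := b0 ha ha0 (hc θ) N
    simp only [hF, Real.norm_eq_abs, abs_mul, abs_of_nonneg (pow_nonneg hρ N)]
    calc _ ≤ |bb B N| * ρ ^ N * (4 * ((N : ℝ) + 1) ^ 1) := by gcongr
      _ = _ := by ring
  have hsum : Summable fun N => ∫ θ, ‖F N θ‖ ∂σ := by
    refine Summable.of_nonneg_of_le (fun N => integral_nonneg fun θ => norm_nonneg _)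
      (fun N => ?_) (((bb_summable B ρ hρ hρ1 1).mul_left 4).mul_right (σ.real Set.univ))
    calc _ ≤ ∫ _, 4 * (|bb B N| * ((N : ℝ) + 1) ^ 1 * ρ ^ N) ∂σ :=
          integral_mono (hFi N).norm (integrable_const _) (hbound N)
      _ = _ := by rw [integral_const, smul_eq_mul, mul_comm]
  have key := hasSum_integral_of_summable_integral_norm hFi hsum
  have h1 : ∀ N, ∫ θ, F N θ ∂σ = mom e 0 *
      (((ascPochhammer ℝ N).eval (((n + 1 : ℕ) : ℝ) / 2 - a) * (ascPochhammer ℝ N).eval B /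
        ((ascPochhammer ℝ N).eval (((n + 1 : ℕ) : ℝ) / 2) * (N.factorial : ℝ))) * ρ ^ N) := by
    intro N
    have h2 := TT_moment e he N a 0
    simp only [mul_zero, pow_zero, one_mul, Nat.cast_zero, add_zero] at h2
    simp only [hF]
    rw [integral_const_mul, h2]
    unfold bb
    have hP := (ascPochhammer_pos N (((n + 1 : ℕ) : ℝ) / 2) (by positivity)).ne'
    have hN : (N.factorial : ℝ) ≠ 0 := by positivity
    field_simp
  have h3 := key.tsum_eq
  rw [tsum_congr h1, tsum_mul_left] at h3
  exact h3.symm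

noncomputable def uu (p : ℝ) (z : EE) : ℝ := max (1 - ‖z‖ ^ 2) 0 ^ p

lemma uu_continuous (p : ℝ) (hp : 0 < p) : Continuous (uu p : EE → ℝ) := by
  unfold uu
  exact ((by fun_prop : Continuous fun z : EE => 1 - ‖z‖ ^ 2).max
    continuous_const).rpow_const (fun _ => Or.inr hp.le)

lemma uu_nonneg (p : ℝ) (z : EE) : 0 ≤ uu p z := by unfold uu; positivity

lemma uu_le (p : ℝ) (hp : 0 < p) (z : EE) : uu p z ≤ 1 := by
  unfold uu
  apply Real.rpow_le_one (le_max_right _ _) _ hp.le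
  apply max_le _ zero_le_one
  nlinarith [sq_nonneg ‖z‖]

/-- the symmetrized integrand -/
noncomputable def GG (α p : ℝ) (x z : EE) : ℝ :=
  (2 * uu p x - uu p (x + z) - uu p (x - z)) / ‖z‖ ^ (((n + 1 : ℕ) : ℝ) + α)

lemma uu_add {p : ℝ} {x θ : EE} {m r : ℝ} (hm : 0 < m) (hmx : m ^ 2 = 1 - ‖x‖ ^ 2)
    (hθ : ‖θ‖ = 1) : uu p (x + r • θ) = (m ^ 2) ^ p * Qp p (inner ℝ x θ / m) (r / m) := by
  unfold uu Qp
  rw [← Real.mul_rpow (by positivity) (le_max_right _ _), mul_max_of_nonneg _ _ (by positivity),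
    mul_zero]
  congr 2
  rw [norm_add_sq_real, inner_smul_right, norm_smul, hθ, mul_one, Real.norm_eq_abs, sq_abs]
  field_simp
  linarith

lemma uu_self {p : ℝ} {x : EE} {m : ℝ} (hm : 0 < m) (hmx : m ^ 2 = 1 - ‖x‖ ^ 2) :
    uu p x = (m ^ 2) ^ p := by
  unfold uu
  rw [← hmx, max_eq_left (by positivity)]

lemma ww_eq {p : ℝ} {x θ : EE} {m r : ℝ} (hm : 0 < m) (hmx : m ^ 2 = 1 - ‖x‖ ^ 2)
    (hθ : ‖θ‖ = 1) : 2 * uu p x - uu p (x + r • θ) - uu p (x - r • θ) =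
      (m ^ 2) ^ p * FF p (inner ℝ x θ / m) (r / m) := by
  have h1 := uu_add (p := p) (r := r) hm hmx hθ
  have h2 := uu_add (p := p) (r := r) hm hmx (θ := -θ) (by rwa [norm_neg])
  rw [smul_neg, ← sub_eq_add_neg, inner_neg_right, neg_div] at h2
  rw [h1, h2, uu_self hm hmx]
  unfold FF
  ring

lemma ww_bound {α : ℝ} (hα : 0 < α) (hα2 : α < 2) {p : ℝ} (hp : 0 < p) {x : EE} (hx : ‖x‖ < 1) :
    ∃ C R : ℝ, 0 < R ∧ ∀ z : EE, (‖z‖ ≤ R → |2 * uu p x - uu p (x + z) - uu p (x - z)| ≤ C * ‖z‖ ^ 2) ∧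
      (R < ‖z‖ → |2 * uu p x - uu p (x + z) - uu p (x - z)| ≤ C) := by
  have hpos : 0 < 1 - ‖x‖ ^ 2 := by nlinarith [norm_nonneg x]
  set m := Real.sqrt (1 - ‖x‖ ^ 2) with hm'
  have hm : 0 < m := Real.sqrt_pos.2 hpos
  have hmx : m ^ 2 = 1 - ‖x‖ ^ 2 := Real.sq_sqrt hpos.le
  have hm1 : m ≤ 1 := by
    rw [hm']; apply Real.sqrt_le_one.2; nlinarith [sq_nonneg ‖x‖]
  obtain ⟨C, hC⟩ := FF_bd hα hα2 p (1 / m) hp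
  refine ⟨(m ^ 2) ^ p * |C| / m ^ 2, m * (2 * (1 / m) + 1), by positivity, fun z => ?_⟩
  rcases eq_or_ne z 0 with hz | hz
  · subst hz
    have : 2 * uu p x - uu p (x + 0) - uu p (x - 0) = 0 := by simp; ring
    rw [this]
    constructor
    · intro _; simp
    · intro _; rw [abs_zero]; positivity
  · have hzn : 0 < ‖z‖ := norm_pos_iff.2 hz
    set θ := ‖z‖⁻¹ • z with hθ'
    have hθ : ‖θ‖ = 1 := by rw [hθ', norm_smul, norm_inv, norm_norm, inv_mul_cancel₀ hzn.ne']
    have hzθ : z = ‖z‖ • θ := by rw [hθ', smul_smul, mul_inv_cancel₀ hzn.ne', one_smul]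
    have ht : |inner ℝ x θ / m| ≤ 1 / m := by
      rw [abs_div, abs_of_pos hm]
      gcongr
      have := abs_real_inner_le_norm x θ
      rw [hθ] at this; linarith
    obtain ⟨h1, h2⟩ := hC _ ht
    have hw := ww_eq (p := p) (r := ‖z‖) hm hmx hθ
    rw [← hzθ] at hw
    rw [hw, abs_mul, abs_of_nonneg (by positivity : 0 ≤ (m ^ 2) ^ p)]
    constructor
    · intro hzR
      have h3 := h1 (‖z‖ / m) (by positivity) (by rwa [div_le_iff₀ hm, mul_comm])
      calc _ ≤ (m ^ 2) ^ p * (|C| * (‖z‖ / m) ^ 2) := by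
            gcongr; exact h3.trans (by gcongr; exact le_abs_self C)
        _ = _ := by rw [div_pow]; ring
    · intro hzR
      have h3 := h2 (‖z‖ / m) (by rwa [lt_div_iff₀ hm, mul_comm])
      rw [mul_div_assoc]
      refine mul_le_mul_of_nonneg_left ?_ (by positivity)
      refine (h3.trans (le_abs_self C)).trans ?_
      rw [le_div_iff₀ (by positivity)]
      have : m ^ 2 ≤ 1 := by rw [hmx]; nlinarith [sq_nonneg ‖x‖]
      nlinarith [abs_nonneg C]

lemma pow_div_rpow {α r : ℝ} (hr : 0 < r) :
    r ^ n / r ^ (((n + 1 : ℕ) : ℝ) + α) = r ^ (-1 - α) := by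
  rw [← Real.rpow_natCast r n, ← Real.rpow_sub hr]
  congr 1; push_cast; ring

lemma GG_measurable {α p : ℝ} (hp : 0 < p) (x : EE) : Measurable (GG α p x) := by
  have h := (uu_continuous (n := n) p hp).measurable
  unfold GG
  fun_prop

lemma GG_integrable {α : ℝ} (hα : 0 < α) (hα2 : α < 2) {p : ℝ} (hp : 0 < p) {x : EE}
    (hx : ‖x‖ < 1) : Integrable (GG α p x) := by
  obtain ⟨C, R, hR, hC⟩ := ww_bound hα hα2 hp hx
  set f : ℝ → ℝ := fun s => (if s ≤ R then C * s ^ 2 else C) / s ^ (((n + 1 : ℕ) : ℝ) + α) with hf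
  have hdim : Module.finrank ℝ EE - 1 = n := by simp
  have hi : Integrable (fun z : EE => f ‖z‖) := by
    rw [integrable_fun_norm_addHaar (volume : Measure EE) (f := f), hdim]
    refine (bd_integrable α R C hα hα2 hR).congr_fun (fun r hr => ?_) measurableSet_Ioi
    have hr : 0 < r := hr
    simp only [hf, bd, smul_eq_mul]
    rw [mul_div_left_comm, pow_div_rpow hr]
    split_ifs
    · have e : r ^ (1 - α) = r ^ 2 * r ^ (-1 - α) := by
        rw [← Real.rpow_natCast, ← Real.rpow_add hr]; congr 1; push_cast; ring
      rw [e]; ring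
    · rfl
  refine hi.mono' (GG_measurable hp x).aestronglyMeasurable (Eventually.of_forall fun z => ?_)
  rw [Real.norm_eq_abs, GG, abs_div, abs_of_nonneg (by positivity : 0 ≤ ‖z‖ ^ (((n + 1 : ℕ) : ℝ) + α))]
  simp only [hf]
  gcongr
  split_ifs with h
  · exact (hC z).1 h
  · exact (hC z).2 (not_le.1 h)

lemma trunc_eq {α : ℝ} (hα : 0 < α) {p : ℝ} (hp : 0 < p) (x : EE) {ε : ℝ} (hε : 0 < ε) :
    ∫ y in {y : EE | ε < ‖x - y‖}, (uu p x - uu p y) / ‖x - y‖ ^ (((n + 1 : ℕ) : ℝ) + α) =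
      1 / 2 * ∫ z, Set.indicator {z : EE | ε < ‖z‖} (GG α p x) z := by
  set S : Set EE := {y : EE | ε < ‖x - y‖} with hS
  have hSm : MeasurableSet S := measurableSet_lt measurable_const (by fun_prop)
  set h : EE → ℝ := S.indicator
    (fun y => (uu p x - uu p y) / ‖x - y‖ ^ (((n + 1 : ℕ) : ℝ) + α)) with hh'
  have hum := (uu_continuous (n := n) p hp).measurable
  have hmeas : Measurable h := Measurable.indicator (by fun_prop) hSm
  set f : ℝ → ℝ := fun s => (Set.Ioi ε).indicator (fun s => 1 / s ^ (((n + 1 : ℕ) : ℝ) + α)) s with hf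
  have hdim : Module.finrank ℝ EE - 1 = n := by simp
  have hi : Integrable (fun z : EE => f ‖z‖) := by
    rw [integrable_fun_norm_addHaar (volume : Measure EE) (f := f), hdim]
    have h1 : IntegrableOn (fun r : ℝ => r ^ (-1 - α)) (Set.Ioi ε) :=
      integrableOn_Ioi_rpow_of_lt (by linarith) hε
    have h2 : Integrable ((Set.Ioi ε).indicator fun r : ℝ => r ^ (-1 - α)) :=
      (integrable_indicator_iff measurableSet_Ioi).2 h1
    refine h2.integrableOn.congr_fun (fun r hr => ?_) measurableSet_Ioi
    have hr : 0 < r := hr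
    simp only [hf, smul_eq_mul, Set.indicator]
    split_ifs
    · rw [← pow_div_rpow (n := n) hr]; ring
    · simp
  have hb : ∀ y : EE, ‖h y‖ ≤ f ‖x - y‖ := by
    intro y
    simp only [hh', hf, Set.indicator, hS, Set.mem_setOf_eq, Set.mem_Ioi]
    split_ifs
    · rw [Real.norm_eq_abs, abs_div,
        abs_of_nonneg (by positivity : 0 ≤ ‖x - y‖ ^ (((n + 1 : ℕ) : ℝ) + α))]
      gcongr
      rw [abs_le]
      have := uu_nonneg p x
      have := uu_nonneg p y
      have := uu_le p hp x
      have := uu_le p hp y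
      constructor <;> linarith
    · simp
  have hint : Integrable h :=
    (hi.comp_sub_left x).mono' hmeas.aestronglyMeasurable (Eventually.of_forall hb)
  have e1 : ∫ z, h (x + z) = ∫ y, h y := integral_add_left_eq_self h x
  have e2 : ∫ z, h (x - z) = ∫ y, h y := integral_sub_left_eq_self h volume x
  have hi1 : Integrable (fun z => h (x + z)) := hint.comp_add_left x
  have hi2 : Integrable (fun z => h (x - z)) := hint.comp_sub_left x
  have e3 : ∫ z, Set.indicator {z : EE | ε < ‖z‖} (GG α p x) z = ∫ z, (h (x + z) + h (x - z)) := by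
    congr 1
    funext z
    simp only [hh', hS, Set.indicator, Set.mem_setOf_eq, GG, sub_add_cancel_left, norm_neg,
      sub_sub_cancel]
    split_ifs
    · ring
    · simp
  rw [e3, integral_add hi1 hi2, e1, e2, ← integral_indicator hSm]
  ring

lemma trunc_tendsto {α : ℝ} (hα : 0 < α) (hα2 : α < 2) {p : ℝ} (hp : 0 < p) {x : EE}
    (hx : ‖x‖ < 1) :
    Tendsto (fun ε : ℝ => ∫ z, Set.indicator {z : EE | ε < ‖z‖} (GG α p x) z)
      (nhdsWithin 0 (Set.Ioi 0)) (nhds (∫ z, GG α p x z)) := by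
  refine tendsto_integral_filter_of_dominated_convergence (fun z => ‖GG α p x z‖) ?_ ?_
    (GG_integrable hα hα2 hp hx).norm ?_
  · refine Eventually.of_forall fun ε => ?_
    exact ((GG_measurable hp x).indicator
      (measurableSet_lt measurable_const (by fun_prop))).aestronglyMeasurable
  · exact Eventually.of_forall fun ε => Eventually.of_forall fun z => norm_indicator_le_norm_self _ _
  · refine Eventually.of_forall fun z => ?_
    rcases eq_or_ne z 0 with hz | hz
    · subst hz
      have h0 : GG α p x 0 = 0 := by
        have : 2 * uu p x - uu p (x + 0) - uu p (x - 0) = 0 := by simp; ring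
        rw [GG, this, zero_div]
      rw [h0]
      refine tendsto_const_nhds.congr fun ε => ?_
      simp [Set.indicator, h0]
    · refine tendsto_const_nhds.congr' ?_
      have : ∀ᶠ ε in nhdsWithin (0 : ℝ) (Set.Ioi 0), ε < ‖z‖ :=
        nhdsWithin_le_nhds (gt_mem_nhds (norm_pos_iff.2 hz))
      filter_upwards [this] with ε hε
      rw [Set.indicator_of_mem (by exact hε)]

lemma GG_integral {α : ℝ} (hα : 0 < α) (hα2 : α < 2) {p : ℝ} (hp : 0 < p) {x : EE}
    (hx : ‖x‖ < 1) : ∫ z, GG α p x z = Cc α p *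
      (2 * Real.pi ^ (((n + 1 : ℕ) : ℝ) / 2) / Real.Gamma (((n + 1 : ℕ) : ℝ) / 2)) *
      hyp2F1 ((α + ((n + 1 : ℕ) : ℝ)) / 2) (α / 2 - p) (((n + 1 : ℕ) : ℝ) / 2) (‖x‖ ^ 2) := by
  have hpos : 0 < 1 - ‖x‖ ^ 2 := by nlinarith [norm_nonneg x]
  set ρ := ‖x‖ ^ 2 with hρd
  have hρ : 0 ≤ ρ := by positivity
  have hρ1 : ρ < 1 := by linarith
  set m := Real.sqrt (1 - ρ) with hm'
  have hm : 0 < m := Real.sqrt_pos.2 hpos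
  have hmx : m ^ 2 = 1 - ρ := Real.sq_sqrt hpos.le
  obtain ⟨e, he, hxe⟩ : ∃ e : EE, ‖e‖ = 1 ∧ x = ‖x‖ • e := by
    rcases eq_or_ne x 0 with h | h
    · refine ⟨EuclideanSpace.single 0 1, by simp, ?_⟩
      rw [h]; simp
    · have hn : ‖x‖ ≠ 0 := norm_ne_zero_iff.2 h
      refine ⟨‖x‖⁻¹ • x, ?_, ?_⟩
      · rw [norm_smul, norm_inv, norm_norm, inv_mul_cancel₀ hn]
      · rw [smul_smul, mul_inv_cancel₀ hn, one_smul]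
  rw [polar _ (GG_integrable hα hα2 hp hx)]
  have hinner : ∀ θ : Metric.sphere (0 : EE) 1,
      ∫ r in Set.Ioi (0 : ℝ), r ^ n * GG α p x (r • (θ : EE)) =
        Cc α p * fS (α / 2 - p) (-α / 2) ρ (inner ℝ e (θ : EE)) := by
    intro θ
    have hθ : ‖(θ : EE)‖ = 1 := by simp
    have hc : inner ℝ e (θ : EE) ∈ Set.Ioo (-(5/4) : ℝ) (5/4) := by
      have := abs_real_inner_le_norm e (θ : EE)
      rw [he, hθ] at this
      have := abs_le.1 this
      constructor <;> linarith [this.1, this.2]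
    set t := inner ℝ x (θ : EE) / m with ht
    have htk : t = ‖x‖ / m * inner ℝ e (θ : EE) := by
      rw [ht]
      nth_rewrite 1 [hxe]
      rw [real_inner_smul_left]; ring
    have hκ : (‖x‖ / m) ^ 2 * (1 - ρ) = ρ := by
      rw [div_pow, ← hmx, ← hρd]; field_simp
    have h1 : ∫ r in Set.Ioi (0 : ℝ), r ^ n * GG α p x (r • (θ : EE)) =
        ∫ r in Set.Ioi (0 : ℝ), ((m ^ 2) ^ p * (m⁻¹) ^ (1 + α)) *
          (FF p t (m⁻¹ * r) * (m⁻¹ * r) ^ (-1 - α)) := by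
      refine setIntegral_congr_fun measurableSet_Ioi fun r hr => ?_
      have hr : 0 < r := hr
      simp only [GG]
      rw [ww_eq hm hmx hθ, norm_smul, hθ, mul_one, Real.norm_of_nonneg hr.le, ← ht,
        mul_div_left_comm, pow_div_rpow hr, Real.mul_rpow (by positivity) hr.le]
      have e1 : (m⁻¹) ^ (1 + α) * (m⁻¹) ^ (-1 - α) = 1 := by
        rw [← Real.rpow_add (by positivity)]
        have : 1 + α + (-1 - α) = 0 := by ring
        rw [this, Real.rpow_zero]
      have e2 : r / m = m⁻¹ * r := by ring
      rw [e2]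
      linear_combination (-(m ^ 2) ^ p * FF p t (m⁻¹ * r) * r ^ (-1 - α)) * e1
    rw [h1, integral_const_mul, integral_comp_mul_left_Ioi (fun s => FF p t s * s ^ (-1 - α)) 0
      (by positivity : 0 < m⁻¹), mul_zero, smul_eq_mul, inv_inv]
    change (m ^ 2) ^ p * m⁻¹ ^ (1 + α) * (m * hh α p t) = _
    rw [htk, hh_eq hρ hρ1 hα hα2 hκ hp _ hc]
    have e3 : (m ^ 2) ^ p * m⁻¹ ^ (1 + α) * m * (1 - ρ) ^ (α / 2 - p) = 1 := by
      rw [← hmx, ← Real.rpow_natCast, ← Real.rpow_mul hm.le, ← Real.rpow_mul hm.le,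
        Real.inv_rpow hm.le, ← Real.rpow_neg hm.le, ← Real.rpow_add hm, ← Real.rpow_add_one hm.ne',
        ← Real.rpow_add hm]
      have : ((2 : ℕ) : ℝ) * p + -(1 + α) + 1 + ((2 : ℕ) : ℝ) * (α / 2 - p) = 0 := by
        push_cast; ring
      rw [this, Real.rpow_zero]
    linear_combination (Cc α p * fS (α / 2 - p) (-α / 2) ρ (inner ℝ e (θ : EE))) * e3
  simp only [hinner]
  rw [integral_const_mul, fS_sphere e he hρ hρ1 (by linarith) (by linarith), mom_zero e he]
  have : ((n + 1 : ℕ) : ℝ) / 2 - -α / 2 = (α + ((n + 1 : ℕ) : ℝ)) / 2 := by ring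
  rw [this]
  ring

end pv

lemma Gamma_neg_half {α : ℝ} (hα : 0 < α) (hα2 : α < 2) :
    |Real.Gamma (-α / 2)| = 2 / α * Real.Gamma (1 - α / 2) := by
  have h := Real.Gamma_add_one (s := -α / 2) (by linarith)
  have e : -α / 2 + 1 = 1 - α / 2 := by ring
  rw [e] at h
  have hg : 0 < Real.Gamma (1 - α / 2) := Real.Gamma_pos_of_pos (by linarith)
  have h2 : Real.Gamma (-α / 2) = -(2 / α * Real.Gamma (1 - α / 2)) := by
    rw [h]; field_simp
  rw [h2, abs_neg, abs_of_pos (by positivity)]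

theorem dyda_formula (d : ℕ) (α : ℝ) (hα : 0 < α) (hα2 : α < 2)
    (p : ℝ) (hp : 0 < p) (hpα : ¬ ∃ n : ℕ, p + 1 - α / 2 = -(n : ℝ))
    (x : EuclideanSpace ℝ (Fin d)) (hx : ‖x‖ < 1) :
    fracLapPV d α (fun z => max (1 - ‖z‖ ^ 2) 0 ^ p) x
      ((2 ^ α * Real.Gamma ((α + d) / 2) * Real.Gamma (p + 1) /
          (Real.Gamma ((d : ℝ) / 2) * Real.Gamma (p + 1 - α / 2))) *
        hyp2F1 ((α + d) / 2) (α / 2 - p) ((d : ℝ) / 2) (‖x‖ ^ 2)) := by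
  cases d with
  | zero =>
    unfold fracLapPV
    have h0 : Real.Gamma (((0 : ℕ) : ℝ) / 2) = 0 := by simp [Real.Gamma_zero]
    rw [h0, zero_mul, div_zero, zero_mul]
    refine tendsto_const_nhds.congr' ?_
    filter_upwards [self_mem_nhdsWithin] with ε hε
    have : {y : EuclideanSpace ℝ (Fin 0) | ε < ‖x - y‖} = ∅ := by
      ext y
      have : x - y = 0 := Subsingleton.elim _ _
      simp only [Set.mem_setOf_eq, this, norm_zero, Set.mem_empty_iff_false, iff_false, not_lt]
      exact (Set.mem_Ioi.1 hε).le
    rw [this]; simp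
  | succ n =>
    unfold fracLapPV
    have h1 := ((trunc_tendsto hα hα2 hp hx).const_mul (1 / 2)).const_mul (cFrac (n + 1) α)
    have h2 : cFrac (n + 1) α * (1 / 2 * ∫ z, GG α p x z) =
      (2 ^ α * Real.Gamma ((α + ((n + 1 : ℕ) : ℝ)) / 2) * Real.Gamma (p + 1) /
          (Real.Gamma (((n + 1 : ℕ) : ℝ) / 2) * Real.Gamma (p + 1 - α / 2))) *
        hyp2F1 ((α + ((n + 1 : ℕ) : ℝ)) / 2) (α / 2 - p) (((n + 1 : ℕ) : ℝ) / 2) (‖x‖ ^ 2) := by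
      rw [GG_integral hα hα2 hp hx, cFrac, Cc, Gamma_neg_half hα hα2]
      have hg1 : Real.Gamma (1 - α / 2) ≠ 0 := (Real.Gamma_pos_of_pos (by linarith)).ne'
      have hg2 : Real.Gamma (((n + 1 : ℕ) : ℝ) / 2) ≠ 0 :=
        (Real.Gamma_pos_of_pos (by positivity)).ne'
      have hpi : Real.pi ^ (((n + 1 : ℕ) : ℝ) / 2) ≠ 0 := (Real.rpow_pos_of_pos Real.pi_pos _).ne'
      have hg3 : Real.Gamma (p + 1 - α / 2) ≠ 0 := (Real.Gamma_pos_of_pos (by linarith)).ne'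
      generalize Real.Gamma (1 - α / 2) = g1 at *
      generalize Real.Gamma (((n + 1 : ℕ) : ℝ) / 2) = g2 at *
      generalize Real.Gamma (p + 1 - α / 2) = g3 at *
      generalize Real.pi ^ (((n + 1 : ℕ) : ℝ) / 2) = g4 at *
      generalize hyp2F1 ((α + ((n + 1 : ℕ) : ℝ)) / 2) (α / 2 - p) (((n + 1 : ℕ) : ℝ) / 2)
        (‖x‖ ^ 2) = g5
      generalize Real.Gamma ((α + ((n + 1 : ℕ) : ℝ)) / 2) = g6
      field_simp
    rw [h2] at h1
    refine h1.congr' ?_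
    filter_upwards [self_mem_nhdsWithin] with ε hε
    have h3 := trunc_eq hα hp x (Set.mem_Ioi.1 hε)
    rw [← h3]
    rfl
end

section
/- Let d = 1 and β = (α−1)/2 with 1 < α < 2, so 0 < β < 1/2 and β is not an integer. Then the function x ↦ (1+x²)^β on ℝ tends to +∞ as |x| → ∞ like |x|^{2β}, and its distributional Fourier transform away from the origin is given by ω ↦ (2^{1+β}/Γ(−β)) |ω|^{−β−1/2} K_{1/2+β}(|ω|), which is negative for ω ≠ 0 since Γ(−β) < 0 for 0 < β < 1. -/
open MeasureTheory Filter

/-- The modified Bessel function of the second kind `K_ν(z)` of real order, via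
`K_ν(z) = ∫_0^∞ e^{−z cosh t} cosh(ν t) dt` (valid for `z > 0`). -/
noncomputable def besselKr (ν z : ℝ) : ℝ :=
  ∫ t in Set.Ioi (0 : ℝ), Real.exp (-z * Real.cosh t) * Real.cosh (ν * t)

/-- The 1D Fourier transform with convention `(2π)^{−1/2} ∫ f(t) e^{−itω} dt`. -/
noncomputable def fourierT1 (f : ℝ → ℂ) (ω : ℝ) : ℂ :=
  (((2 * Real.pi) ^ (-(1 : ℝ) / 2) : ℝ) : ℂ) *
    ∫ t : ℝ, f t * Complex.exp (-Complex.I * (t : ℂ) * (ω : ℂ))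


lemma aux_exp_int {p a : ℝ} (hp : -1 < p) (ha : 0 < a) :
    IntegrableOn (fun s : ℝ => s ^ p * Real.exp (-(a * s))) (Set.Ioi 0) := by
  have := integrableOn_rpow_mul_exp_neg_mul_rpow (p := 1) hp one_pos ha
  simpa using this

lemma aux_sub_int {a β : ℝ} (ha : 0 < a) (hβ : 0 < β) (hβ1 : β < 1) :
    IntegrableOn (fun s : ℝ => (1 - Real.exp (-(a * s))) * s ^ (-β - 1)) (Set.Ioi 0) := by
  have hm : Measurable (fun s : ℝ => (1 - Real.exp (-(a * s))) * s ^ (-β - 1)) := by fun_prop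
  rw [← Set.Ioc_union_Ioi_eq_Ioi (zero_le_one' ℝ), integrableOn_union]
  constructor
  · have h1 : IntegrableOn (fun s : ℝ => a * s ^ (-β)) (Set.Ioc 0 1) := by
      have := intervalIntegral.intervalIntegrable_rpow' (a := 0) (b := 1) (r := -β) (by linarith)
      rw [intervalIntegrable_iff_integrableOn_Ioc_of_le zero_le_one] at this
      exact this.const_mul a
    refine Integrable.mono' h1 hm.aestronglyMeasurable ?_
    filter_upwards [ae_restrict_mem measurableSet_Ioc] with s hs
    have hs0 : 0 < s := hs.1
    have e1 : Real.exp (-(a * s)) ≤ 1 := Real.exp_le_one_iff.2 (by nlinarith)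
    have e2 : 1 - a * s ≤ Real.exp (-(a * s)) := by
      have := Real.add_one_le_exp (-(a * s)); linarith
    have hp : 0 < s ^ (-β - 1) := Real.rpow_pos_of_pos hs0 _
    rw [Real.norm_of_nonneg (mul_nonneg (by linarith) hp.le)]
    have : s ^ (-β) = s * s ^ (-β - 1) := by
      rw [Real.rpow_sub_one hs0.ne']; field_simp
    rw [this, ← mul_assoc]
    gcongr
    linarith
  · have h1 := integrableOn_Ioi_rpow_of_lt (a := -β - 1) (by linarith) (zero_lt_one' ℝ)
    refine Integrable.mono' h1 hm.aestronglyMeasurable ?_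
    filter_upwards [ae_restrict_mem measurableSet_Ioi] with s hs
    have hs0 : 0 < s := lt_trans zero_lt_one hs
    have e1 : Real.exp (-(a * s)) ≤ 1 := Real.exp_le_one_iff.2 (by nlinarith)
    have e2 := Real.exp_pos (-(a * s))
    have hp : 0 < s ^ (-β - 1) := Real.rpow_pos_of_pos hs0 _
    rw [Real.norm_of_nonneg (mul_nonneg (by linarith) hp.le)]
    nlinarith

lemma aux_gamma_neg {β : ℝ} (hβ : 0 < β) (hβ1 : β < 1) : Real.Gamma (-β) < 0 := by
  have h := Real.Gamma_add_one (s := -β) (by linarith)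
  have h2 := Real.Gamma_pos_of_pos (s := -β + 1) (by linarith)
  nlinarith

lemma aux_sub_integral {a β : ℝ} (ha : 0 < a) (hβ : 0 < β) (hβ1 : β < 1) :
    ∫ s in Set.Ioi (0 : ℝ), (1 - Real.exp (-(a * s))) * s ^ (-β - 1)
      = - Real.Gamma (-β) * a ^ β := by
  have hint := aux_sub_int ha hβ hβ1
  have hint2 : IntegrableOn (fun s : ℝ => (a * Real.exp (-(a * s))) * (-(s ^ (-β)) / β))
      (Set.Ioi 0) := by
    have h : IntegrableOn (fun s : ℝ => (-a / β) * (s ^ (-β) * Real.exp (-(a * s)))) (Set.Ioi 0) :=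
      (aux_exp_int (p := -β) (by linarith) ha).const_mul (-a / β)
    refine h.congr_fun (fun s _ => ?_) measurableSet_Ioi
    ring
  have key := integral_Ioi_mul_deriv_eq_deriv_mul (a := 0) (a' := 0) (b' := 0)
    (u := fun s : ℝ => 1 - Real.exp (-(a * s))) (v := fun s : ℝ => -(s ^ (-β)) / β)
    (u' := fun s : ℝ => a * Real.exp (-(a * s))) (v' := fun s : ℝ => s ^ (-β - 1))
    ?_ ?_ hint hint2 ?_ ?_
  · rw [key]
    have : ∀ s : ℝ, a * Real.exp (-(a * s)) * (-(s ^ (-β)) / β)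
      = (-a / β) * (s ^ ((1 - β) - 1) * Real.exp (-(a * s))) := by
      intro s; rw [show (1 - β) - 1 = -β by ring]; ring
    simp_rw [this]
    rw [integral_const_mul, Real.integral_rpow_mul_exp_neg_mul_Ioi (by linarith) ha]
    have h := Real.Gamma_add_one (s := -β) (by linarith)
    rw [show -β + 1 = 1 - β by ring] at h
    rw [h, one_div, Real.inv_rpow ha.le, ← Real.rpow_neg ha.le, neg_sub,
      Real.rpow_sub_one ha.ne']
    field_simp
    try ring
  · intro s _
    have h : HasDerivAt (fun s : ℝ => -(a * s)) (-(a * 1)) s :=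
      ((hasDerivAt_id s).const_mul a).neg
    refine (h.exp.const_sub 1).congr_deriv ?_
    ring
  · intro s hs
    have h := ((Real.hasDerivAt_rpow_const (x := s) (p := -β) (Or.inl (ne_of_gt hs))).neg).div_const β
    refine h.congr_deriv ?_
    field_simp
  · have h0 : Tendsto (fun s : ℝ => a / β * s ^ (1 - β)) (nhdsWithin 0 (Set.Ioi 0)) (nhds 0) := by
      have : ContinuousAt (fun s : ℝ => a / β * s ^ (1 - β)) 0 := by
        refine ContinuousAt.mul continuousAt_const ?_
        exact Real.continuousAt_rpow_const _ _ (Or.inr (by linarith))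
      have h2 := this.tendsto.mono_left (nhdsWithin_le_nhds (s := Set.Ioi 0))
      simpa [Real.zero_rpow (show 1 - β ≠ 0 by linarith)] using h2
    refine squeeze_zero_norm' ?_ h0
    filter_upwards [self_mem_nhdsWithin] with s hs
    have hs0 : 0 < s := hs
    have e1 : Real.exp (-(a * s)) ≤ 1 := Real.exp_le_one_iff.2 (by nlinarith)
    have e2 : 1 - a * s ≤ Real.exp (-(a * s)) := by
      have := Real.add_one_le_exp (-(a * s)); linarith
    have hp : 0 < s ^ (-β) := Real.rpow_pos_of_pos hs0 _
    simp only [Pi.mul_apply, norm_mul, norm_div, norm_neg]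
    rw [Real.norm_of_nonneg (by linarith : 0 ≤ 1 - Real.exp (-(a * s))), Real.norm_of_nonneg hp.le,
      Real.norm_of_nonneg hβ.le]
    have : s ^ (1 - β) = s * s ^ (-β) := by
      rw [show 1 - β = 1 + -β by ring, Real.rpow_add hs0, Real.rpow_one]
    rw [this]
    calc _ ≤ (a * s) * (s ^ (-β) / β) := by gcongr; linarith
      _ = _ := by ring
  · have h0 : Tendsto (fun s : ℝ => s ^ (-β) / β) atTop (nhds 0) := by
      simpa using (tendsto_rpow_neg_atTop hβ).div_const β
    refine squeeze_zero_norm' ?_ h0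
    filter_upwards [eventually_gt_atTop 0] with s hs0
    have e1 : Real.exp (-(a * s)) ≤ 1 := Real.exp_le_one_iff.2 (by nlinarith)
    have e2 := Real.exp_pos (-(a * s))
    have hp : 0 < s ^ (-β) := Real.rpow_pos_of_pos hs0 _
    simp only [Pi.mul_apply, norm_mul, norm_div, norm_neg]
    rw [Real.norm_of_nonneg (by linarith : 0 ≤ 1 - Real.exp (-(a * s))), Real.norm_of_nonneg hp.le,
      Real.norm_of_nonneg hβ.le]
    exact mul_le_of_le_one_left (by positivity) (by linarith)

/-- bound for the Bessel-type kernel -/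
lemma aux_ker_bound {c p s : ℝ} (hc : 0 < c) (hs : 0 < s) :
    s ^ p * Real.exp (-s - c / s) ≤ 2 / c ^ 2 * (s ^ (p + 2) * Real.exp (-(1 * s))) := by
  have h := Real.quadratic_le_exp_of_nonneg (x := c / s) (by positivity)
  have h1 : (c / s) ^ 2 / 2 ≤ Real.exp (c / s) := by
    have : 0 < c / s := by positivity
    linarith
  have h2 : Real.exp (-(c / s)) ≤ 2 / c ^ 2 * s ^ 2 := by
    rw [Real.exp_neg]
    have := inv_anti₀ (by positivity) h1
    refine this.trans (le_of_eq ?_)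
    field_simp
  rw [sub_eq_add_neg, Real.exp_add, Real.rpow_add hs, one_mul]
  have : s ^ (2 : ℝ) = s ^ 2 := by norm_cast
  rw [this]
  have hp : 0 < s ^ p := Real.rpow_pos_of_pos hs _
  have he := Real.exp_pos (-s)
  calc _ = (s ^ p * Real.exp (-s)) * Real.exp (-(c / s)) := by ring
    _ ≤ (s ^ p * Real.exp (-s)) * (2 / c ^ 2 * s ^ 2) := by gcongr
    _ = _ := by ring

lemma aux_ker_int {c p : ℝ} (hc : 0 < c) (hp : -3 < p) :
    IntegrableOn (fun s : ℝ => s ^ p * Real.exp (-s - c / s)) (Set.Ioi 0) := by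
  refine Integrable.mono' ((aux_exp_int (p := p + 2) (a := 1) (by linarith)
    one_pos).const_mul (2 / c ^ 2)) (by fun_prop) ?_
  filter_upwards [ae_restrict_mem measurableSet_Ioi] with s hs
  have hs0 : 0 < s := hs
  rw [Real.norm_of_nonneg (by positivity)]
  exact aux_ker_bound hc hs0

lemma aux_image {c : ℝ} (hc : 0 < c) :
    (fun t : ℝ => c * Real.exp t) '' Set.univ = Set.Ioi 0 := by
  ext s
  simp only [Set.image_univ, Set.mem_range, Set.mem_Ioi]
  constructor
  · rintro ⟨t, rfl⟩; positivity
  · intro hs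
    exact ⟨Real.log (s / c), by rw [Real.exp_log (by positivity)]; field_simp⟩

lemma aux_subst {z ν t : ℝ} (hz : 0 < z) :
    |z / 2 * Real.exp t| • ((z / 2 * Real.exp t) ^ (-ν - 1) *
      Real.exp (-(z / 2 * Real.exp t) - (z ^ 2 / 4) / (z / 2 * Real.exp t)))
    = (z / 2) ^ (-ν) * (Real.exp (-z * Real.cosh t) * Real.exp (-(ν * t))) := by
  have he := Real.exp_pos t
  have hx : 0 < z / 2 * Real.exp t := by positivity
  rw [abs_of_pos hx, smul_eq_mul, Real.rpow_sub_one hx.ne', Real.mul_rpow (by positivity) he.le,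
    ← Real.exp_mul, Real.cosh_eq, Real.exp_neg t]
  have : -(z / 2 * Real.exp t) - (z ^ 2 / 4) / (z / 2 * Real.exp t)
    = -z * ((Real.exp t + (Real.exp t)⁻¹) / 2) := by field_simp; ring
  rw [this, show t * -ν = -(ν * t) by ring]
  field_simp

lemma aux_bessel_int {z ν : ℝ} (hz : 0 < z) (hν : ν < 2) :
    Integrable (fun t : ℝ => Real.exp (-z * Real.cosh t) * Real.exp (-(ν * t))) := by
  have h := aux_ker_int (c := z ^ 2 / 4) (p := -ν - 1) (by positivity) (by linarith)
  rw [← aux_image (c := z / 2) (by positivity),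
    integrableOn_image_iff_integrableOn_abs_deriv_smul (f' := fun t => z / 2 * Real.exp t)
      MeasurableSet.univ
      (fun t _ => ((Real.hasDerivAt_exp t).const_mul _).hasDerivWithinAt) 
      (fun x _ y _ hxy => by
        have : z / 2 * Real.exp x = z / 2 * Real.exp y := hxy
        exact Real.exp_injective (mul_left_cancel₀ (by positivity) this))] at h
  simp_rw [aux_subst hz] at h
  rw [integrableOn_univ] at h
  have h2 := h.const_mul (((z / 2) ^ (-ν))⁻¹)
  refine h2.congr (Eventually.of_forall fun t => ?_)
  have : (z / 2) ^ (-ν) ≠ 0 := (Real.rpow_pos_of_pos (by positivity) _).ne'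
  simp only
  field_simp

lemma aux_bessel_cosh_int {z ν : ℝ} (hz : 0 < z) (hν : ν < 2) :
    Integrable (fun t : ℝ => Real.exp (-z * Real.cosh t) * Real.cosh (ν * t)) := by
  have h := aux_bessel_int hz hν
  have h2 := h.comp_neg
  refine ((h.add h2).div_const 2).congr (Eventually.of_forall fun t => ?_)
  simp only [Pi.add_apply, Real.cosh_neg, Real.cosh_eq (ν * t)]
  rw [mul_neg, neg_neg]
  ring

lemma aux_bessel_pos {z ν : ℝ} (hz : 0 < z) (hν : ν < 2) : 0 < besselKr ν z := by
  unfold besselKr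
  rw [setIntegral_pos_iff_support_of_nonneg_ae]
  · have : Function.support (fun t : ℝ => Real.exp (-z * Real.cosh t) * Real.cosh (ν * t)) 
      = Set.univ := by
      ext t
      simp [(Real.cosh_pos _).ne', (Real.exp_pos _).ne']
    rw [this]; simp
  · exact Eventually.of_forall fun t => by
      have := Real.cosh_pos (ν * t)
      simp only [Pi.zero_apply]
      positivity
  · exact (aux_bessel_cosh_int hz hν).integrableOn

lemma aux_bessel_eq {z ν : ℝ} (hz : 0 < z) (hν : ν < 2) :
    ∫ s in Set.Ioi (0 : ℝ), s ^ (-ν - 1) * Real.exp (-s - (z ^ 2 / 4) / s)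
      = (z / 2) ^ (-ν) * (2 * besselKr ν z) := by
  rw [← aux_image (c := z / 2) (by positivity),
    integral_image_eq_integral_abs_deriv_smul (f' := fun t => z / 2 * Real.exp t)
      MeasurableSet.univ
      (fun t _ => ((Real.hasDerivAt_exp t).const_mul _).hasDerivWithinAt) 
      (fun x _ y _ hxy => by
        have : z / 2 * Real.exp x = z / 2 * Real.exp y := hxy
        exact Real.exp_injective (mul_left_cancel₀ (by positivity) this))]
  simp_rw [aux_subst hz]
  rw [integral_const_mul, setIntegral_univ]
  congr 1
  have h := aux_bessel_int hz hν
  have h2 := h.comp_neg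
  unfold besselKr
  rw [← integral_comp_abs (f := fun t : ℝ => Real.exp (-z * Real.cosh t) * Real.cosh (ν * t))]
  have e : ∀ t : ℝ, Real.exp (-z * Real.cosh |t|) * Real.cosh (ν * |t|) =
      (Real.exp (-z * Real.cosh t) * Real.exp (-(ν * t)) +
        Real.exp (-z * Real.cosh (-t)) * Real.exp (-(ν * -t))) / 2 := by
    intro t
    have : Real.cosh (ν * |t|) = Real.cosh (ν * t) := by
      rw [← Real.cosh_abs (ν * |t|), ← Real.cosh_abs (ν * t)]; simp [abs_mul]
    rw [Real.cosh_abs, this, Real.cosh_neg, Real.cosh_eq (ν * t), mul_neg, neg_neg]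
    ring
  simp_rw [e]
  rw [integral_div, integral_add h h2, integral_neg_eq_self
    (fun t : ℝ => Real.exp (-z * Real.cosh t) * Real.exp (-(ν * t)))]
  ring

lemma aux_fT1_eq (φ : SchwartzMap ℝ ℂ) (x : ℝ) :
    fourierT1 (⇑φ) x = (((2 * Real.pi) ^ (-(1 : ℝ) / 2) : ℝ) : ℂ) *
      (FourierTransform.fourier φ : SchwartzMap ℝ ℂ) (x / (2 * Real.pi)) := by
  unfold fourierT1
  rw [SchwartzMap.fourier_coe, Real.fourier_real_eq_integral_exp_smul]
  congr 1
  refine integral_congr_ae (Eventually.of_forall fun t => ?_)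
  simp only [smul_eq_mul]
  rw [mul_comm]
  congr 2
  have : (Real.pi : ℂ) ≠ 0 := by exact_mod_cast Real.pi_ne_zero
  push_cast
  field_simp

lemma aux_fT1_cont (φ : SchwartzMap ℝ ℂ) : Continuous (fourierT1 (⇑φ)) := by
  have : fourierT1 (⇑φ) = fun x => (((2 * Real.pi) ^ (-(1 : ℝ) / 2) : ℝ) : ℂ) *
      (FourierTransform.fourier φ : SchwartzMap ℝ ℂ) (x / (2 * Real.pi)) :=
    funext (aux_fT1_eq φ)
  rw [this]
  refine continuous_const.mul ((SchwartzMap.continuous _).comp (by fun_prop))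

lemma aux_fT1_int (φ : SchwartzMap ℝ ℂ) : Integrable (fourierT1 (⇑φ)) := by
  have : fourierT1 (⇑φ) = fun x => (((2 * Real.pi) ^ (-(1 : ℝ) / 2) : ℝ) : ℂ) *
      (FourierTransform.fourier φ : SchwartzMap ℝ ℂ) (x / (2 * Real.pi)) :=
    funext (aux_fT1_eq φ)
  rw [this]
  refine Integrable.const_mul ?_ _
  exact (SchwartzMap.integrable (μ := volume)
    (FourierTransform.fourier φ : SchwartzMap ℝ ℂ)).comp_div (by positivity)

lemma aux_fT1_int2 (φ : SchwartzMap ℝ ℂ) :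
    Integrable (fun x => (1 + x ^ 2) * ‖fourierT1 (⇑φ) x‖) := by
  have h2 : Integrable (fun x => x ^ 2 * ‖fourierT1 (⇑φ) x‖) := by
    have h := (SchwartzMap.integrable_pow_mul volume
      (FourierTransform.fourier φ : SchwartzMap ℝ ℂ) 2).comp_div
        (R := 2 * Real.pi) (by positivity)
    refine (h.const_mul ((2 * Real.pi) ^ 2 * (2 * Real.pi) ^ (-(1 : ℝ) / 2))).congr
      (Eventually.of_forall fun x => ?_)
    simp only
    have hcp : 0 < (2 * Real.pi) ^ (-(1 : ℝ) / 2) := by positivity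
    rw [aux_fT1_eq, norm_mul, Complex.norm_real, Real.norm_of_nonneg hcp.le,
      Real.norm_eq_abs, sq_abs]
    have := Real.pi_ne_zero
    rw [div_pow]
    field_simp
  refine ((aux_fT1_int φ).norm.add h2).congr (Eventually.of_forall fun x => ?_)
  simp only [Pi.add_apply]
  ring

lemma aux_fT1_integral (φ : SchwartzMap ℝ ℂ) (h0 : φ 0 = 0) :
    ∫ x, fourierT1 (⇑φ) x = 0 := by
  simp_rw [aux_fT1_eq]
  rw [integral_const_mul, Measure.integral_comp_div
    (fun x => (FourierTransform.fourier φ : SchwartzMap ℝ ℂ) x)]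
  have h : (FourierTransformInv.fourierInv (FourierTransform.fourier φ : SchwartzMap ℝ ℂ)
    : SchwartzMap ℝ ℂ) 0 = φ 0 := by
    rw [FourierTransform.fourierInv_fourier_eq]
  rw [SchwartzMap.fourierInv_coe, Real.fourierInv_eq'] at h
  simp only [inner_zero_right, mul_zero, Complex.ofReal_zero, zero_mul, Complex.exp_zero,
    one_smul] at h
  rw [h, h0]
  simp

lemma aux_gauss (φ : SchwartzMap ℝ ℂ) {s : ℝ} (hs : 0 < s) :
    ∫ x : ℝ, ((Real.exp (-(s * x ^ 2)) : ℝ) : ℂ) * fourierT1 (⇑φ) x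
      = ∫ ω : ℝ, (((2 * s) ^ (-(1 : ℝ) / 2) * Real.exp (-(ω ^ 2 / 4 / s)) : ℝ) : ℂ) * φ ω := by
  unfold fourierT1
  set c : ℝ := (2 * Real.pi) ^ (-(1 : ℝ) / 2) with hc
  have e1 : ∀ x : ℝ, ((Real.exp (-(s * x ^ 2)) : ℝ) : ℂ) * ((c : ℂ) *
      ∫ t : ℝ, φ t * Complex.exp (-Complex.I * (t : ℂ) * (x : ℂ)))
      = ∫ t : ℝ, (c : ℂ) * (((Real.exp (-(s * x ^ 2)) : ℝ) : ℂ) *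
        (φ t * Complex.exp (-Complex.I * (t : ℂ) * (x : ℂ)))) := by
    intro x
    rw [integral_const_mul, integral_const_mul]; ring
  simp_rw [e1]
  rw [integral_integral_swap]
  · refine integral_congr_ae (Eventually.of_forall fun ω => ?_)
    simp only
    have e2 : ∀ x : ℝ, (c : ℂ) * (((Real.exp (-(s * x ^ 2)) : ℝ) : ℂ) *
        (φ ω * Complex.exp (-Complex.I * (ω : ℂ) * (x : ℂ))))
        = ((c : ℂ) * φ ω) * (Complex.exp (Complex.I * ((-ω : ℝ) : ℂ) * x) *
            Complex.exp (-(s : ℂ) * x ^ 2)) := by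
      intro x
      push_cast
      rw [show -Complex.I * (ω : ℂ) * (x : ℂ) = Complex.I * -ω * x by ring,
        show -((s : ℂ) * x ^ 2) = -(s : ℂ) * x ^ 2 by ring]
      ring
    simp_rw [e2]
    rw [integral_const_mul, fourierIntegral_gaussian (by simpa using hs)]
    have e3 : ((Real.pi : ℂ) / (s : ℂ)) ^ (1 / 2 : ℂ) = (((Real.pi / s) ^ (1 / 2 : ℝ) : ℝ) : ℂ) := by
      rw [Complex.ofReal_cpow (by positivity)]
      push_cast
      rfl
    have e4 : Complex.exp (-((-ω : ℝ) : ℂ) ^ 2 / (4 * (s : ℂ)))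
        = ((Real.exp (-(ω ^ 2 / 4 / s)) : ℝ) : ℂ) := by
      push_cast
      congr 1
      have : (s : ℂ) ≠ 0 := by exact_mod_cast hs.ne'
      field_simp
    have e5 : (2 * s) ^ (-(1 : ℝ) / 2) = c * (Real.pi / s) ^ (1 / 2 : ℝ) := by
      rw [hc, neg_div, Real.rpow_neg (by positivity), Real.rpow_neg (by positivity),
        ← Real.inv_rpow (by positivity), ← Real.inv_rpow (by positivity),
        ← Real.mul_rpow (by positivity) (by positivity)]
      congr 1
      have := Real.pi_ne_zero
      field_simp
    rw [e3, e4, e5]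
    push_cast
    ring
  · have hg : Integrable (fun x : ℝ => ((Real.exp (-(s * x ^ 2)) : ℝ) : ℂ)) := by
      have := (integrable_exp_neg_mul_sq hs).ofReal (𝕜 := ℂ)
      simpa using this
    have hp := hg.mul_prod (φ.integrable (μ := volume))
    refine (hp.const_mul (c : ℂ)).mono ?_ (Eventually.of_forall ?_)
    · refine Continuous.aestronglyMeasurable ?_
      have := φ.continuous
      simp only [Function.uncurry_def]
      fun_prop
    · rintro ⟨x, t⟩
      simp only [Function.uncurry_apply_pair, norm_mul]
      have : ‖Complex.exp (-Complex.I * (t : ℂ) * (x : ℂ))‖ = 1 := by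
        rw [show -Complex.I * (t : ℂ) * (x : ℂ) = ((-(t * x) : ℝ) : ℂ) * Complex.I by
          push_cast; ring]
        exact Complex.norm_exp_ofReal_mul_I _
      rw [this, mul_one]

lemma aux_main {β : ℝ} (hβ : 0 < β) (hβ1 : β < 1) (φ : SchwartzMap ℝ ℂ)
    (hφ : tsupport ⇑φ ⊆ {ω : ℝ | ω ≠ 0}) :
    (∫ x : ℝ, (((1 + x ^ 2) ^ β : ℝ) : ℂ) * fourierT1 (⇑φ) x) =
        ∫ ω : ℝ,
          (((2 ^ (1 + β) / Real.Gamma (-β)) * |ω| ^ (-β - 1 / 2) *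
              besselKr (1 / 2 + β) |ω| : ℝ) : ℂ) * φ ω := by
  have hG := aux_gamma_neg hβ hβ1
  have h0 : (0 : ℝ) ∉ tsupport ⇑φ := fun h => hφ h rfl
  have hφ0 : φ 0 = 0 := image_eq_zero_of_notMem_tsupport h0
  obtain ⟨δ, hδ, hball⟩ := Metric.isOpen_iff.1 (isClosed_tsupport (⇑φ)).isOpen_compl 0 h0
  have hsupp : ∀ ω : ℝ, |ω| < δ → φ ω = 0 := by
    intro ω hω
    refine image_eq_zero_of_notMem_tsupport (hball ?_)
    simpa [Metric.mem_ball, Real.dist_eq] using hω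
  -- first interchange
  have hm1 : AEStronglyMeasurable (Function.uncurry fun (x s : ℝ) =>
      (((1 - Real.exp (-((1 + x ^ 2) * s))) * s ^ (-β - 1) : ℝ) : ℂ) * fourierT1 (⇑φ) x)
      (volume.prod (volume.restrict (Set.Ioi 0))) := by
    refine Measurable.aestronglyMeasurable ?_
    have := (aux_fT1_cont φ).measurable
    simp only [Function.uncurry_def]
    fun_prop
  have hnn : ∀ x s : ℝ, 0 < s → 0 ≤ (1 - Real.exp (-((1 + x ^ 2) * s))) * s ^ (-β - 1) := by
    intro x s hs
    refine mul_nonneg ?_ (by positivity)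
    rw [sub_nonneg]
    exact Real.exp_le_one_iff.2 (neg_nonpos.2 (by positivity))
  have hI1 : Integrable (Function.uncurry fun (x s : ℝ) =>
      (((1 - Real.exp (-((1 + x ^ 2) * s))) * s ^ (-β - 1) : ℝ) : ℂ) * fourierT1 (⇑φ) x)
      (volume.prod (volume.restrict (Set.Ioi 0))) := by
    rw [integrable_prod_iff hm1]
    constructor
    · refine Eventually.of_forall fun x => ?_
      simp only [Function.uncurry_apply_pair]
      exact ((aux_sub_int (a := 1 + x ^ 2) (by positivity) hβ hβ1).ofReal (𝕜 := ℂ)).mul_const _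
    · have e : ∀ x : ℝ, ∫ s in Set.Ioi (0 : ℝ), ‖Function.uncurry (fun (x s : ℝ) =>
          (((1 - Real.exp (-((1 + x ^ 2) * s))) * s ^ (-β - 1) : ℝ) : ℂ) * fourierT1 (⇑φ) x) (x, s)‖
          = - Real.Gamma (-β) * (1 + x ^ 2) ^ β * ‖fourierT1 (⇑φ) x‖ := by
        intro x
        rw [← aux_sub_integral (a := 1 + x ^ 2) (by positivity) hβ hβ1, ← integral_mul_const]
        refine setIntegral_congr_fun measurableSet_Ioi fun s hs => ?_
        simp only [Function.uncurry_apply_pair]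
        rw [norm_mul, Complex.norm_real, Real.norm_of_nonneg (hnn x s hs)]
      simp_rw [e]
      refine ((aux_fT1_int2 φ).const_mul (- Real.Gamma (-β))).mono' ?_ (Eventually.of_forall ?_)
      · refine Measurable.aestronglyMeasurable ?_
        have := (aux_fT1_cont φ).measurable
        fun_prop
      · intro x
        have h1 : (1 + x ^ 2) ^ β ≤ 1 + x ^ 2 := by
          have := Real.rpow_le_rpow_of_exponent_le (x := 1 + x ^ 2) (by nlinarith [sq_nonneg x])
            hβ1.le
          simpa using this
        have hG' : 0 < - Real.Gamma (-β) := by linarith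
        rw [Real.norm_of_nonneg (by positivity), mul_assoc]
        gcongr
  have hsw1 := integral_integral_swap hI1
  -- second interchange
  have hI2 : Integrable (Function.uncurry fun (ω s : ℝ) =>
      ((s ^ (-(1 / 2 + β) - 1) * Real.exp (-s - (|ω| ^ 2 / 4) / s) : ℝ) : ℂ) * φ ω)
      (volume.prod (volume.restrict (Set.Ioi 0))) := by
    have hk := (aux_ker_int (c := δ ^ 2 / 4) (p := -(1 / 2 + β) - 1) (by positivity)
      (by linarith)).ofReal (𝕜 := ℂ)
    have hp := (φ.integrable (μ := volume)).mul_prod hk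
    refine hp.mono ?_ ?_
    · refine Measurable.aestronglyMeasurable ?_
      have := φ.continuous.measurable
      simp only [Function.uncurry_def]
      fun_prop
    · have : ∀ᵐ z : ℝ × ℝ ∂(volume.prod (volume.restrict (Set.Ioi 0))), z.2 ∈ Set.Ioi (0 : ℝ) :=
        Measure.quasiMeasurePreserving_snd.ae (ae_restrict_mem measurableSet_Ioi)
      filter_upwards [this]
      rintro ⟨ω, s⟩ hs
      have hs0 : 0 < s := hs
      simp only [Function.uncurry_apply_pair, norm_mul]
      by_cases hω : |ω| < δ
      · simp [hsupp ω hω]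
      · push Not at hω
        rw [mul_comm]
        refine mul_le_mul_of_nonneg_left ?_ (norm_nonneg _)
        have hnn2 : ∀ c : ℝ, 0 ≤ s ^ (-(1 / 2 + β) - 1) * Real.exp (-s - c / s) :=
          fun c => by positivity
        rw [RCLike.norm_ofReal, Complex.norm_real, Real.norm_eq_abs, abs_of_nonneg (hnn2 _),
          abs_of_nonneg (hnn2 _)]
        gcongr
  have hsw2 := integral_integral_swap hI2
  have hL : ∀ x : ℝ, ∫ s in Set.Ioi (0 : ℝ),
      (((1 - Real.exp (-((1 + x ^ 2) * s))) * s ^ (-β - 1) : ℝ) : ℂ) * fourierT1 (⇑φ) x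
      = ((- Real.Gamma (-β) : ℝ) : ℂ) * ((((1 + x ^ 2) ^ β : ℝ) : ℂ) * fourierT1 (⇑φ) x) := by
    intro x
    rw [integral_mul_const, integral_complex_ofReal,
      aux_sub_integral (a := 1 + x ^ 2) (by positivity) hβ hβ1]
    push_cast
    ring
  have hR : ∀ ω : ℝ, ∫ s in Set.Ioi (0 : ℝ),
      ((s ^ (-(1 / 2 + β) - 1) * Real.exp (-s - (|ω| ^ 2 / 4) / s) : ℝ) : ℂ) * φ ω
      = (((|ω| / 2) ^ (-(1 / 2 + β)) * (2 * besselKr (1 / 2 + β) |ω|) : ℝ) : ℂ) * φ ω := by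
    intro ω
    by_cases hω : ω = 0
    · subst hω; simp [hφ0]
    · rw [integral_mul_const, integral_complex_ofReal,
        aux_bessel_eq (abs_pos.2 hω) (by linarith)]
  have hM : ∀ s ∈ Set.Ioi (0 : ℝ), ∫ x : ℝ,
      (((1 - Real.exp (-((1 + x ^ 2) * s))) * s ^ (-β - 1) : ℝ) : ℂ) * fourierT1 (⇑φ) x
      = ((-(2 : ℝ) ^ (-(1 : ℝ) / 2) : ℝ) : ℂ) * ∫ ω : ℝ,
        ((s ^ (-(1 / 2 + β) - 1) * Real.exp (-s - (|ω| ^ 2 / 4) / s) : ℝ) : ℂ) * φ ω := by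
    intro s hs
    have hs0 : 0 < s := hs
    have hF := aux_fT1_int φ
    have e1 : ∀ x : ℝ,
      (((1 - Real.exp (-((1 + x ^ 2) * s))) * s ^ (-β - 1) : ℝ) : ℂ) * fourierT1 (⇑φ) x
      = ((s ^ (-β - 1) : ℝ) : ℂ) * fourierT1 (⇑φ) x - ((s ^ (-β - 1) * Real.exp (-s) : ℝ) : ℂ) *
        (((Real.exp (-(s * x ^ 2)) : ℝ) : ℂ) * fourierT1 (⇑φ) x) := by
      intro x
      rw [show -((1 + x ^ 2) * s) = -s + -(s * x ^ 2) by ring, Real.exp_add]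
      push_cast
      ring
    have hF2 : Integrable (fun x : ℝ =>
        ((Real.exp (-(s * x ^ 2)) : ℝ) : ℂ) * fourierT1 (⇑φ) x) := by
      refine hF.mono ?_ (Eventually.of_forall fun x => ?_)
      · refine Continuous.aestronglyMeasurable ?_
        have := aux_fT1_cont φ
        fun_prop
      · rw [norm_mul, Complex.norm_real, Real.norm_of_nonneg (Real.exp_pos _).le]
        exact mul_le_of_le_one_left (norm_nonneg _)
          (Real.exp_le_one_iff.2 (neg_nonpos.2 (by positivity)))
    simp_rw [e1]
    rw [integral_sub (hF.const_mul _) (hF2.const_mul _), integral_const_mul, integral_const_mul,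
      aux_fT1_integral φ hφ0, aux_gauss φ hs0, mul_zero, zero_sub, ← integral_const_mul,
      ← integral_const_mul, ← integral_neg]
    refine integral_congr_ae (Eventually.of_forall fun ω => ?_)
    simp only
    have e2 : s ^ (-(1 / 2 + β) - 1) = s ^ (-β - 1) * s ^ (-(1 : ℝ) / 2) := by
      rw [← Real.rpow_add hs0]; congr 1; ring
    rw [e2, sub_eq_add_neg (-s), Real.exp_add, Real.mul_rpow (by norm_num) hs0.le, sq_abs]
    push_cast
    ring
  simp_rw [hL] at hsw1
  simp_rw [hR] at hsw2
  rw [setIntegral_congr_fun measurableSet_Ioi hM, integral_const_mul, integral_const_mul,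
    ← hsw2] at hsw1
  have hGc : ((- Real.Gamma (-β) : ℝ) : ℂ) ≠ 0 := by
    exact_mod_cast (by linarith : (0 : ℝ) < - Real.Gamma (-β)).ne'
  refine mul_left_cancel₀ hGc (hsw1.trans ?_)
  rw [← integral_const_mul, ← integral_const_mul]
  refine integral_congr_ae (Eventually.of_forall fun ω => ?_)
  simp only
  rw [← mul_assoc (((-(2 : ℝ) ^ (-(1 : ℝ) / 2) : ℝ) : ℂ)),
    ← mul_assoc (((- Real.Gamma (-β) : ℝ) : ℂ)), ← Complex.ofReal_mul, ← Complex.ofReal_mul]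
  congr 2
  have e3 : (2 : ℝ) ^ (1 + β) = 2 ^ (-(1 : ℝ) / 2) * 2 ^ (1 / 2 + β) * 2 := by
    rw [← Real.rpow_add (by norm_num), ← Real.rpow_add_one (by norm_num)]; congr 1; ring
  rw [Real.div_rpow (abs_nonneg _) (by norm_num), Real.rpow_neg (by norm_num : (0 : ℝ) ≤ 2), e3,
    show -(1 / 2 + β) = -β - 1 / 2 by ring]
  have h2 : (2 : ℝ) ^ (1 / 2 + β) ≠ 0 := by positivity
  have hG0 := hG.ne
  field_simp

lemma aux_equiv {β : ℝ} :
    Asymptotics.IsEquivalent (Filter.comap abs Filter.atTop)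
      (fun x : ℝ => (1 + x ^ 2) ^ β) (fun x : ℝ => |x| ^ (2 * β)) := by
  have hev : ∀ᶠ x : ℝ in Filter.comap abs Filter.atTop, 0 < |x| :=
    tendsto_comap.eventually (eventually_gt_atTop 0)
  refine Asymptotics.isEquivalent_of_tendsto_one ?_
  have h1 : Tendsto (fun y : ℝ => ((y ^ 2)⁻¹ + 1) ^ β) atTop (nhds 1) := by
    have h : Tendsto (fun y : ℝ => (y ^ 2)⁻¹ + 1) atTop (nhds 1) := by
      simpa using ((tendsto_pow_atTop (α := ℝ) two_ne_zero).inv_tendsto_atTop).add_const 1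
    simpa using h.rpow_const (p := β) (Or.inl one_ne_zero)
  refine (h1.comp tendsto_comap).congr' ?_
  filter_upwards [hev] with x hx
  simp only [Function.comp_apply, Pi.div_apply]
  rw [Real.rpow_mul hx.le, ← Real.div_rpow (by positivity) (by positivity)]
  congr 1
  have : |x| ^ (2 : ℝ) = x ^ 2 := by
    rw [← sq_abs x]; norm_cast
  have hx0 : x ≠ 0 := abs_pos.1 hx
  rw [this, sq_abs]
  field_simp

/-- let `d = 1`, `β = (α−1)/2` with `1 < α < 2` (so `0 < β < 1/2`,
not an integer). Then `x ↦ (1+x²)^β` tends to `+∞` as `|x| → ∞` like `|x|^{2β}`;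
its distributional Fourier transform away from the origin (tested against
Schwartz functions supported away from `0`) is
`g(ω) = (2^{1+β}/Γ(−β)) |ω|^{−β−1/2} K_{1/2+β}(|ω|)`; and `g(ω) < 0` for
`ω ≠ 0` since `Γ(−β) < 0` for `0 < β < 1`. -/
theorem gmq_growth_fourier_negative (α β : ℝ) (hα : 1 < α) (hα2 : α < 2)
    (hβ : β = (α - 1) / 2) :
    (0 < β ∧ β < 1 / 2) ∧
    Filter.Tendsto (fun x : ℝ => (1 + x ^ 2) ^ β) (Filter.comap abs Filter.atTop)
      Filter.atTop ∧
    Asymptotics.IsEquivalent (Filter.comap abs Filter.atTop)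
      (fun x : ℝ => (1 + x ^ 2) ^ β) (fun x : ℝ => |x| ^ (2 * β)) ∧
    Real.Gamma (-β) < 0 ∧
    (∀ ω : ℝ, ω ≠ 0 →
      (2 ^ (1 + β) / Real.Gamma (-β)) * |ω| ^ (-β - 1 / 2) *
        besselKr (1 / 2 + β) |ω| < 0) ∧
    (∀ φ : SchwartzMap ℝ ℂ, tsupport ⇑φ ⊆ {ω : ℝ | ω ≠ 0} →
      (∫ x : ℝ, (((1 + x ^ 2) ^ β : ℝ) : ℂ) * fourierT1 (⇑φ) x) =
        ∫ ω : ℝ,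
          (((2 ^ (1 + β) / Real.Gamma (-β)) * |ω| ^ (-β - 1 / 2) *
              besselKr (1 / 2 + β) |ω| : ℝ) : ℂ) * φ ω) := by
  have h0 : 0 < β := by linarith
  have h1 : β < 1 / 2 := by linarith
  have hG := aux_gamma_neg h0 (by linarith : β < 1)
  have heq := aux_equiv (β := β)
  refine ⟨⟨h0, h1⟩, ?_, heq, hG, ?_, fun φ hφ => aux_main h0 (by linarith) φ hφ⟩
  · refine heq.symm.tendsto_atTop ?_
    exact (tendsto_rpow_atTop (by linarith : 0 < 2 * β)).comp tendsto_comap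
  · intro ω hω
    have hω' := abs_pos.2 hω
    have hK := aux_bessel_pos (ν := 1 / 2 + β) hω' (by linarith)
    refine mul_neg_of_neg_of_pos (mul_neg_of_neg_of_pos ?_ (by positivity)) hK
    exact div_neg_of_pos_of_neg (by positivity) hG
end
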